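/- arXiv:2211.14787 — 4 statements merged into one kernel-verified Lean document; each statement's English description precedes it below -/
import Mathlib

section
/- For every integer n ≥ 1, if (α,β,γ) ∈ ℤ³ satisfies αa + βb + γc = n and αγ − β² ≥ 0, then 0 ≤ α ≤ 4nc/|D|, 0 ≤ γ ≤ 4na/|D|, and β² ≤ αγ. In particular, for each fixed n ≥ 1 the set of triples (α,β,γ) ∈ ℤ³ with αa + βb + γc = n and αγ − β² ≥ 0 is finite. -/
/-- For a positive definite integral binary quadratic form `A = [a,b,c]` of
discriminant `D = b² − 4ac < 0` and `n ≥ 1`, any triple `(α,β,γ) ∈ ℤ³` with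
`αa + βb + γc = n` and `αγ − β² ≥ 0` satisfies `0 ≤ α ≤ 4nc/|D|`,
`0 ≤ γ ≤ 4na/|D|` and `β² ≤ αγ`; in particular the set of such triples is finite. -/
theorem binary_form_triple_bounds (a b c : ℤ) (ha : 0 < a)
    (hD : b ^ 2 - 4 * a * c < 0) (n : ℤ) (hn : 1 ≤ n) :
    (∀ α β γ : ℤ, α * a + β * b + γ * c = n → 0 ≤ α * γ - β ^ 2 →
      0 ≤ α ∧ α * |b ^ 2 - 4 * a * c| ≤ 4 * n * c ∧
      0 ≤ γ ∧ γ * |b ^ 2 - 4 * a * c| ≤ 4 * n * a ∧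
      β ^ 2 ≤ α * γ) ∧
    {p : ℤ × ℤ × ℤ | p.1 * a + p.2.1 * b + p.2.2 * c = n ∧
      0 ≤ p.1 * p.2.2 - p.2.1 ^ 2}.Finite := by
  have hc : 0 < c := by
    by_contra h
    have : a * c ≤ 0 := mul_nonpos_of_nonneg_of_nonpos ha.le (not_lt.mp h)
    nlinarith [sq_nonneg b]
  obtain ⟨d, hd⟩ : ∃ d : ℤ, d = |b ^ 2 - 4 * a * c| := ⟨_, rfl⟩
  have hd' : d = 4 * a * c - b ^ 2 := by rw [hd, abs_of_neg hD]; ring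
  have hdpos : 1 ≤ d := by linarith
  have key : ∀ a c α β γ : ℤ, 0 < c → d = 4 * a * c - b ^ 2 →
      α * a + β * b + γ * c = n → 0 ≤ α * γ - β ^ 2 → 0 ≤ α ∧ α * d ≤ 4 * n * c := by
    intro a c α β γ hc hd' h1 h2
    have h3 : α * (α * d) ≤ α * (4 * n * c) := by
      have e : α * (4 * n * c) - α * (α * d)
          = (2 * c * β + b * α) ^ 2 + 4 * c ^ 2 * (α * γ - β ^ 2) := by
        rw [← h1, hd']; ring
      have : 0 ≤ (2 * c * β + b * α) ^ 2 + 4 * c ^ 2 * (α * γ - β ^ 2) := by positivity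
      linarith
    have hnc : 0 < 4 * n * c := by positivity
    have h0 : 0 ≤ α := by
      by_contra h
      push Not at h
      have h4 : 0 < α * (α * d) := mul_pos_of_neg_of_neg h (mul_neg_of_neg_of_pos h (by linarith))
      have h5 : α * (4 * n * c) < 0 := mul_neg_of_neg_of_pos h hnc
      linarith
    refine ⟨h0, ?_⟩
    rcases h0.eq_or_lt with h | h
    · rw [← h]; linarith
    · exact le_of_mul_le_mul_left h3 h
  have main : ∀ α β γ : ℤ, α * a + β * b + γ * c = n → 0 ≤ α * γ - β ^ 2 →
      0 ≤ α ∧ α * d ≤ 4 * n * c ∧ 0 ≤ γ ∧ γ * d ≤ 4 * n * a ∧ β ^ 2 ≤ α * γ := by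
    intro α β γ h1 h2
    obtain ⟨k1, k2⟩ := key a c α β γ hc hd' h1 h2
    obtain ⟨k3, k4⟩ := key c a γ β α ha (by linarith) (by linarith) (by linarith)
    exact ⟨k1, k2, k3, k4, by linarith⟩
  rw [← hd]
  refine ⟨main, ?_⟩
  refine ((Set.finite_Icc 0 (4 * n * c)).prod
    ((Set.finite_Icc (-((4 * n * c) * (4 * n * a))) ((4 * n * c) * (4 * n * a))).prod
      (Set.finite_Icc 0 (4 * n * a)))).subset ?_
  rintro ⟨α, β, γ⟩ ⟨h1, h2⟩
  obtain ⟨k1, k2, k3, k4, k5⟩ := main α β γ h1 h2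
  have m1 : α ≤ 4 * n * c := by nlinarith
  have m2 : γ ≤ 4 * n * a := by nlinarith
  have m3 : α * γ ≤ (4 * n * c) * (4 * n * a) := mul_le_mul m1 m2 k3 (k1.trans m1)
  have m4 : β ≤ β ^ 2 := Int.le_self_sq β
  have m5 : -β ≤ β ^ 2 := by simpa using Int.le_self_sq (-β)
  exact ⟨⟨k1, m1⟩, ⟨by dsimp only; linarith, by dsimp only; linarith⟩, ⟨k3, m2⟩⟩
end

section
/- If τ₀ ∈ ℍ and ϑ_A(τ₀) = 0, then τ₀ is an imaginary quadratic irrationality: there exist integers P, B, C with P > 0 and B² − 4PC < 0 such that Pτ₀² + Bτ₀ + C = 0. -/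
open scoped BigOperators

/-- `q = e^{2πiτ}`. -/
noncomputable def qq (τ : ℂ) : ℂ := Complex.exp (2 * Real.pi * Complex.I * τ)

/-- The binary theta function `ϑ_A(τ) = ∑_{(m,n) ∈ ℤ²} q^{am² + bmn + cn²}`. -/
noncomputable def thetaA (a b c : ℤ) (τ : ℂ) : ℂ :=
  ∑' p : ℤ × ℤ, qq τ ^ (a * p.1 ^ 2 + b * p.1 * p.2 + c * p.2 ^ 2)

open Filter Topology

lemma det_sub_pow_ne_zero (m : ℕ) :
    (Matrix.of fun i j : Fin (m+1) => ((i : ℂ) - (j : ℂ)) ^ m).det ≠ 0 := by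
  have hfac : (Matrix.of fun i j : Fin (m+1) => ((i : ℂ) - (j : ℂ)) ^ m) =
      Matrix.vandermonde (fun i : Fin (m+1) => (i : ℂ)) *
      Matrix.diagonal (fun k : Fin (m+1) => (m.choose k : ℂ)) *
      (Matrix.projVandermonde (fun _ => (1:ℂ)) (fun j : Fin (m+1) => -(j : ℂ))).transpose := by
    ext i j
    rw [Matrix.mul_apply]
    simp only [Matrix.mul_diagonal, Matrix.of_apply, Matrix.vandermonde_apply,
      Matrix.transpose_apply, Matrix.projVandermonde_apply]
    rw [sub_eq_add_neg, add_pow, Finset.sum_range]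
    refine Finset.sum_congr rfl fun k _ => ?_
    have : (k.rev : ℕ) = m - k := by simp [Fin.val_rev]
    rw [this]; ring
  rw [hfac, Matrix.det_mul, Matrix.det_mul, Matrix.det_diagonal, Matrix.det_transpose,
    Matrix.det_projVandermonde]
  refine mul_ne_zero (mul_ne_zero ?_ ?_) ?_
  · rw [Matrix.det_vandermonde_ne_zero_iff]
    intro i j h
    simpa [Fin.ext_iff] using h
  · refine Finset.prod_ne_zero_iff.mpr fun k _ => ?_
    have := Nat.choose_pos (Nat.lt_succ_iff.mp k.2)
    exact_mod_cast this.ne'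
  · refine Finset.prod_ne_zero_iff.mpr fun i _ => Finset.prod_ne_zero_iff.mpr fun j hj => ?_
    have : i < j := by simpa using hj
    intro h
    have h2 : (j : ℂ) = (i : ℂ) := by linear_combination h
    have h3 : (j : ℕ) = (i : ℕ) := by exact_mod_cast h2
    have : (i : ℕ) < j := this
    omega

lemma rank_kernel {F G : ℂ → ℂ} (X Y : Fin 2 × Fin 2 → ℂ → ℂ)
    (hG : ContinuousAt G 0) (hG0 : G 0 ≠ 0)
    (hK : ∀ t s, G (t + s) * F (t - s) = ∑ σ, X σ t * Y σ s)
    (m : ℕ) (g : ℂ → ℂ) (hg : ContinuousAt g 0) (hg0 : g 0 ≠ 0)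
    (hF : ∀ᶠ z in 𝓝 0, F z = z ^ m * g z) : m ≤ 3 := by
  by_contra hm
  push Not at hm
  let M : ℂ → Matrix (Fin (m+1)) (Fin (m+1)) ℂ := fun ε => Matrix.of fun i j =>
    G (ε * i + ε * j) * (((i : ℂ) - (j : ℂ)) ^ m * g (ε * i - ε * j))
  have hcont : ContinuousAt (fun ε => (M ε).det) 0 := by
    have hMc : ContinuousAt M 0 := by
      refine continuousAt_pi.2 fun i => continuousAt_pi.2 fun j => ?_
      refine ContinuousAt.mul ?_ (ContinuousAt.mul continuousAt_const ?_)
      · refine ContinuousAt.comp_of_eq (f := fun ε : ℂ => ε * i + ε * j) hG (by fun_prop) (by simp)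
      · refine ContinuousAt.comp_of_eq (f := fun ε : ℂ => ε * i - ε * j) hg (by fun_prop) (by simp)
    exact (Continuous.matrix_det continuous_id).continuousAt.comp hMc
  have hzero : ∀ᶠ ε in 𝓝[≠] (0:ℂ), (M ε).det = 0 := by
    have h1 : ∀ᶠ ε in 𝓝 (0:ℂ), ∀ i j : Fin (m+1), F (ε * i - ε * j) =
        (ε * i - ε * j) ^ m * g (ε * i - ε * j) := by
      refine eventually_all.2 fun i => eventually_all.2 fun j => ?_
      have hc : Tendsto (fun ε : ℂ => ε * i - ε * j) (𝓝 0) (𝓝 0) := by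
        have : Continuous (fun ε : ℂ => ε * (i:ℂ) - ε * (j:ℂ)) := by fun_prop
        simpa using this.tendsto 0
      exact hc.eventually hF
    filter_upwards [nhdsWithin_le_nhds h1, self_mem_nhdsWithin] with ε hε hne
    have hne : ε ≠ 0 := hne
    have hfac : (Matrix.of fun (i : Fin (m+1)) (σ : Fin 2 × Fin 2) => X σ (ε * i)) *
        (Matrix.of fun (σ : Fin 2 × Fin 2) (j : Fin (m+1)) => Y σ (ε * j)) = (ε ^ m) • M ε := by
      ext i j
      rw [Matrix.mul_apply]
      simp only [Matrix.of_apply, Matrix.smul_apply, smul_eq_mul, M]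
      rw [← hK, hε, show ε * (i:ℂ) - ε * j = ε * (i - j) by ring, mul_pow]
      ring
    by_contra hdet
    have hu : IsUnit ((ε ^ m) • M ε) := by
      rw [Matrix.isUnit_iff_isUnit_det, Matrix.det_smul, isUnit_iff_ne_zero]
      exact mul_ne_zero (pow_ne_zero _ (pow_ne_zero _ hne)) hdet
    have hr := Matrix.rank_of_isUnit _ hu
    rw [← hfac] at hr
    have hr2 := (Matrix.rank_mul_le_left (Matrix.of fun (i : Fin (m+1)) (σ : Fin 2 × Fin 2) => X σ (ε * i))
        (Matrix.of fun (σ : Fin 2 × Fin 2) (j : Fin (m+1)) => Y σ (ε * j))).trans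
        (Matrix.rank_le_card_width _)
    simp at hr hr2
    omega
  have hlim : (M 0).det = 0 := by
    have h1 : Tendsto (fun ε => (M ε).det) (𝓝[≠] 0) (𝓝 (M 0).det) :=
      hcont.tendsto.mono_left nhdsWithin_le_nhds
    have h2 : Tendsto (fun ε => (M ε).det) (𝓝[≠] 0) (𝓝 0) :=
      (tendsto_congr' hzero).2 tendsto_const_nhds
    exact tendsto_nhds_unique h1 h2
  have hM0 : M 0 = (G 0 * g 0) • (Matrix.of fun i j : Fin (m+1) => ((i : ℂ) - (j : ℂ)) ^ m) := by
    ext i j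
    simp [M]; ring
  rw [hM0, Matrix.det_smul] at hlim
  exact mul_ne_zero (pow_ne_zero _ (mul_ne_zero hG0 hg0)) (det_sub_pow_ne_zero m) hlim

lemma order_ge {F : ℂ → ℂ} (hev : ∀ z, F (-z) = F z) (h0 : F 0 = 0)
    (h2 : deriv (deriv F) 0 = 0) (m : ℕ) (g : ℂ → ℂ) (hg : AnalyticAt ℂ g 0) (hg0 : g 0 ≠ 0)
    (hF : ∀ᶠ z in 𝓝 0, F z = z ^ m * g z) : 4 ≤ m := by
  have hm0 : m ≠ 0 := by
    rintro rfl
    have := hF.self_of_nhds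
    simp [h0] at this
    exact hg0 this.symm
  have heven : Even m := by
    by_contra hodd
    rw [Nat.not_even_iff_odd] at hodd
    have hneg : Tendsto (fun z : ℂ => -z) (𝓝 0) (𝓝 0) := by
      simpa using (continuous_neg.tendsto (0:ℂ))
    have h : ∀ᶠ z in 𝓝[≠] (0:ℂ), g z + g (-z) = 0 := by
      filter_upwards [nhdsWithin_le_nhds hF, nhdsWithin_le_nhds (hneg.eventually hF),
        self_mem_nhdsWithin] with z h1 h2 h3
      have h3 : z ≠ 0 := h3
      rw [hev, h1, hodd.neg_pow] at h2
      have : z ^ m * (g z + g (-z)) = 0 := by linear_combination h2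
      exact (mul_eq_zero.1 this).resolve_left (pow_ne_zero _ h3)
    have hc : Tendsto (fun z => g z + g (-z)) (𝓝[≠] 0) (𝓝 (g 0 + g 0)) := by
      refine Tendsto.mono_left (Tendsto.add hg.continuousAt.tendsto ?_) nhdsWithin_le_nhds
      exact hg.continuousAt.tendsto.comp hneg
    have := tendsto_nhds_unique hc ((tendsto_congr' h).2 tendsto_const_nhds)
    apply hg0
    linear_combination this / 2
  have hm2 : m ≠ 2 := by
    rintro rfl
    have h1 : deriv F =ᶠ[𝓝 0] fun z => 2 * z * g z + z ^ 2 * deriv g z := by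
      have hF' : F =ᶠ[𝓝 0] fun z => z ^ 2 * g z := hF
      refine hF'.deriv.trans ?_
      filter_upwards [hg.eventually_analyticAt] with z hz
      have := ((hasDerivAt_pow 2 z).mul hz.differentiableAt.hasDerivAt).deriv
      simp at this
      exact this
    rw [h1.deriv_eq] at h2
    have hd := hg.differentiableAt.hasDerivAt
    have hd2 := hg.deriv.differentiableAt.hasDerivAt
    have e := ((((hasDerivAt_id (0:ℂ)).const_mul 2).mul hd).add ((hasDerivAt_pow 2 (0:ℂ)).mul hd2)).deriv
    simp only [id] at e
    have e' : deriv (fun z => 2 * z * g z + z ^ 2 * deriv g z) 0 = 2 * g 0 := by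
      convert! e using 1
      simp
    rw [e'] at h2
    simp at h2
    exact hg0 h2
  obtain ⟨k, hk⟩ := heven
  omega

lemma fourier_avg {ι : Type*} [Countable ι] (c : ι → ℂ) (hc : Summable fun p => ‖c p‖) (φ : ι → ℤ)
    (h : ∀ t : ℝ, ∑' p, c p * Complex.exp (2 * Real.pi * Complex.I * (φ p * t)) = 0) :
    ∑' p, (if φ p = 0 then c p else 0) = 0 := by
  have key := intervalIntegral.hasSum_integral_of_dominated_convergence (a := 0) (b := 1)
    (μ := MeasureTheory.volume) (F := fun p (t : ℝ) => c p * Complex.exp (2 * Real.pi * Complex.I * (φ p * t)))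
    (f := fun _ => 0) (fun p _ => ‖c p‖) ?_ ?_ ?_ ?_ ?_
  · simp only [intervalIntegral.integral_zero] at key
    refine Eq.trans ?_ key.tsum_eq
    refine tsum_congr fun p => ?_
    rw [intervalIntegral.integral_const_mul]
    split_ifs with hp
    · simp [hp]
    · have hne : 2 * Real.pi * Complex.I * (φ p : ℂ) ≠ 0 := by
        have : (φ p : ℂ) ≠ 0 := by exact_mod_cast hp
        simp [this, Real.pi_ne_zero]
      have := integral_exp_mul_complex (a := 0) (b := 1) hne
      simp only [mul_assoc] at this ⊢
      rw [this]
      have e : Complex.exp (2 * (Real.pi * (Complex.I * ((φ p : ℂ) * ((1:ℝ):ℂ))))) = 1 := by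
        rw [← Complex.exp_int_mul_two_pi_mul_I (φ p)]
        congr 1; push_cast; ring
      rw [e]; simp
  · intro p
    exact (by fun_prop : Continuous _).aestronglyMeasurable
  · intro p
    refine Eventually.of_forall fun t _ => ?_
    rw [norm_mul, Complex.norm_exp]
    simp
  · exact Eventually.of_forall fun t _ => hc
  · exact intervalIntegrable_const
  · refine Eventually.of_forall fun t _ => ?_
    have hs : Summable fun p => c p * Complex.exp (2 * Real.pi * Complex.I * (φ p * t)) := by
      refine Summable.of_norm (hc.congr fun p => ?_)
      rw [norm_mul, Complex.norm_exp]
      simp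
    have := hs.hasSum
    rwa [h t] at this

/-- The general term of the two-variable theta function attached to the form `(a,b,c)`. -/
noncomputable def thTerm (a b c : ℤ) (τ x y : ℂ) (p : ℤ × ℤ) : ℂ :=
  Complex.exp (2 * Real.pi * Complex.I * (τ * (a * p.1 ^ 2 + b * p.1 * p.2 + c * p.2 ^ 2)
    + (p.1 * x + p.2 * y)))

/-- The theta function with elliptic variables. -/
noncomputable def Th (a b c : ℤ) (τ x y : ℂ) : ℂ := ∑' p, thTerm a b c τ x y p

lemma form_lower (a b c : ℤ) (ha : 0 < a) (hD : b ^ 2 - 4 * a * c < 0) :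
    ∃ δ : ℝ, 0 < δ ∧ ∀ m n : ℝ, δ * (m ^ 2 + n ^ 2) ≤ a * m ^ 2 + b * m * n + c * n ^ 2 := by
  have hc : 0 < c := by nlinarith [sq_nonneg b]
  have ha' : (0:ℝ) < a := by exact_mod_cast ha
  have hc' : (0:ℝ) < c := by exact_mod_cast hc
  have hD' : (b:ℝ) ^ 2 - 4 * a * c < 0 := by exact_mod_cast hD
  refine ⟨(4 * a * c - b ^ 2) / (4 * (a + c)), by apply div_pos <;> linarith, fun m n => ?_⟩
  set δ : ℝ := (4 * a * c - b ^ 2) / (4 * (a + c)) with hδ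
  have h1 : 4 * δ * (a + c) = 4 * a * c - b ^ 2 := by rw [hδ]; field_simp
  have hlt : δ < a := by
    rw [hδ, div_lt_iff₀ (by linarith)]
    nlinarith [sq_nonneg (b:ℝ)]
  have h3 : 0 ≤ 4 * (a - δ) * (a * m ^ 2 + b * m * n + c * n ^ 2 - δ * (m ^ 2 + n ^ 2)) := by
    have : 4 * (a - δ) * (a * m ^ 2 + b * m * n + c * n ^ 2 - δ * (m ^ 2 + n ^ 2)) =
        (2 * (a - δ) * m + b * n) ^ 2 + (2 * δ * n) ^ 2 := by
      linear_combination (-n^2) * h1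
    rw [this]; positivity
  have := nonneg_of_mul_nonneg_right h3 (by linarith : 0 < 4 * ((a:ℝ) - δ))
  linarith

/-- The dominating Gaussian. -/
noncomputable def gbound (T R : ℝ) (p : ℤ × ℤ) : ℝ :=
  Real.exp (-Real.pi * (T * p.1 ^ 2 - 2 * R * |(p.1 : ℝ)|)) *
  Real.exp (-Real.pi * (T * p.2 ^ 2 - 2 * R * |(p.2 : ℝ)|))

lemma gbound_summable {T : ℝ} (hT : 0 < T) (R : ℝ) : Summable (gbound T R) := by
  have h := summable_pow_mul_jacobiTheta₂_term_bound R hT 0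
  simp only [pow_zero, one_mul] at h
  have h' : Summable (fun n : ℤ => Real.exp (-Real.pi * (T * n ^ 2 - 2 * R * |(n : ℝ)|))) := by
    simpa using h
  exact h'.mul_of_nonneg h' (fun _ => (Real.exp_pos _).le) (fun _ => (Real.exp_pos _).le)

lemma thTerm_bound (a b c : ℤ) (ha : 0 < a) (hD : b ^ 2 - 4 * a * c < 0) (τ : ℂ) (hτ : 0 < τ.im) :
    ∃ T : ℝ, 0 < T ∧ ∀ R x y, ‖x‖ ≤ R → ‖y‖ ≤ R → ∀ p, ‖thTerm a b c τ x y p‖ ≤ gbound T R p := by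
  obtain ⟨δ, hδ, h⟩ := form_lower a b c ha hD
  refine ⟨2 * τ.im * δ, by positivity, fun R x y hx hy p => ?_⟩
  rw [thTerm, Complex.norm_exp, gbound, ← Real.exp_add, Real.exp_le_exp]
  have e : (2 * Real.pi * Complex.I * (τ * (a * p.1 ^ 2 + b * p.1 * p.2 + c * p.2 ^ 2)
    + (p.1 * x + p.2 * y))).re = -2 * Real.pi * (τ.im * (a * p.1 ^ 2 + b * p.1 * p.2 + c * p.2 ^ 2)
    + (p.1 * x.im + p.2 * y.im)) := by
    have e1 : (τ * (a * p.1 ^ 2 + b * p.1 * p.2 + c * p.2 ^ 2)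
      + (p.1 * x + p.2 * y)).im = τ.im * (a * p.1 ^ 2 + b * p.1 * p.2 + c * p.2 ^ 2)
      + (p.1 * x.im + p.2 * y.im) := by
      have : (τ * (a * p.1 ^ 2 + b * p.1 * p.2 + c * p.2 ^ 2)
        + (p.1 * x + p.2 * y)) = τ * ((a * p.1 ^ 2 + b * p.1 * p.2 + c * p.2 ^ 2 : ℤ) : ℂ)
        + ((p.1 : ℤ) * x + (p.2 : ℤ) * y) := by push_cast; ring
      rw [this]
      simp only [Complex.add_im, Complex.mul_im, Complex.intCast_re, Complex.intCast_im]
      push_cast; ring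
    rw [show ∀ w : ℂ, 2 * Real.pi * Complex.I * w = ((2 * Real.pi : ℝ) : ℂ) * (Complex.I * w) by
      intro w; push_cast; ring, Complex.re_ofReal_mul, Complex.I_mul_re, e1]
    ring
  rw [e]
  have h1 := mul_le_mul_of_nonneg_left (h p.1 p.2) hτ.le
  have hx' : -(p.1 * x.im) ≤ R * |(p.1:ℝ)| := by
    have : |p.1 * x.im| ≤ R * |(p.1:ℝ)| := by
      rw [abs_mul, mul_comm]
      exact mul_le_mul_of_nonneg_right ((Complex.abs_im_le_norm x).trans hx) (abs_nonneg _)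
    exact (neg_le_abs _).trans this
  have hy' : -(p.2 * y.im) ≤ R * |(p.2:ℝ)| := by
    have : |p.2 * y.im| ≤ R * |(p.2:ℝ)| := by
      rw [abs_mul, mul_comm]
      exact mul_le_mul_of_nonneg_right ((Complex.abs_im_le_norm y).trans hy) (abs_nonneg _)
    exact (neg_le_abs _).trans this
  have := mul_le_mul_of_nonneg_left (add_le_add h1 (add_le_add (neg_le_neg hx') (neg_le_neg hy')))
    Real.pi_pos.le
  nlinarith [this]

lemma thTerm_summable (a b c : ℤ) (ha : 0 < a) (hD : b ^ 2 - 4 * a * c < 0) (τ : ℂ) (hτ : 0 < τ.im)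
    (x y : ℂ) : Summable fun p => ‖thTerm a b c τ x y p‖ := by
  obtain ⟨T, hT, h⟩ := thTerm_bound a b c ha hD τ hτ
  exact Summable.of_nonneg_of_le (fun _ => norm_nonneg _)
    (h (max ‖x‖ ‖y‖) x y (le_max_left _ _) (le_max_right _ _)) (gbound_summable hT _)

lemma Th_neg (a b c : ℤ) (τ x y : ℂ) : Th a b c τ (-x) (-y) = Th a b c τ x y := by
  unfold Th
  rw [← (Equiv.neg (ℤ × ℤ)).tsum_eq]
  refine tsum_congr fun p => ?_
  simp only [thTerm, Equiv.neg_apply, Prod.fst_neg, Prod.snd_neg]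
  congr 1; push_cast; ring

lemma thTerm_deriv (a b c : ℤ) (τ x y u v : ℂ) (p : ℤ × ℤ) (t : ℂ) :
    HasDerivAt (fun t => thTerm a b c τ (x + t * u) (y + t * v) p)
      (2 * Real.pi * Complex.I * (p.1 * u + p.2 * v) * thTerm a b c τ (x + t * u) (y + t * v) p) t := by
  unfold thTerm
  have h1 : HasDerivAt (fun t : ℂ => 2 * Real.pi * Complex.I *
      (τ * (a * p.1 ^ 2 + b * p.1 * p.2 + c * p.2 ^ 2) + (p.1 * (x + t * u) + p.2 * (y + t * v))))
      (2 * Real.pi * Complex.I * (p.1 * u + p.2 * v)) t := by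
    have hx : HasDerivAt (fun t : ℂ => x + t * u) u t := by
      simpa using ((hasDerivAt_id t).mul_const u).const_add x
    have hy : HasDerivAt (fun t : ℂ => y + t * v) v t := by
      simpa using ((hasDerivAt_id t).mul_const v).const_add y
    exact (((hx.const_mul _).add (hy.const_mul _)).const_add _).const_mul _
  exact h1.cexp.congr_deriv (mul_comm _ _)

lemma Th_differentiable (a b c : ℤ) (ha : 0 < a) (hD : b ^ 2 - 4 * a * c < 0) (τ : ℂ)
    (hτ : 0 < τ.im) (x y u v : ℂ) :
    Differentiable ℂ (fun t => Th a b c τ (x + t * u) (y + t * v)) := by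
  intro t
  obtain ⟨T, hT, h⟩ := thTerm_bound a b c ha hD τ hτ
  let r := ‖t‖ + 1
  let R := max (‖x‖ + r * ‖u‖) (‖y‖ + r * ‖v‖)
  have := Complex.differentiableOn_tsum_of_summable_norm (U := Metric.ball 0 r)
    (F := fun p t => thTerm a b c τ (x + t * u) (y + t * v) p) (gbound_summable hT R)
    (fun p w _ => (thTerm_deriv a b c τ x y u v p w).differentiableAt.differentiableWithinAt)
    Metric.isOpen_ball ?_
  · exact this.differentiableAt (Metric.isOpen_ball.mem_nhds (by simp [r]))
  · intro p w hw
    have hw : ‖w‖ ≤ r := by simpa using (mem_ball_zero_iff.1 hw).le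
    refine h R _ _ ?_ ?_ p
    · refine (norm_add_le _ _).trans (le_trans ?_ (le_max_left _ _))
      rw [norm_mul]; gcongr
    · refine (norm_add_le _ _).trans (le_trans ?_ (le_max_right _ _))
      rw [norm_mul]; gcongr

lemma Th_deriv2 (a b c : ℤ) (ha : 0 < a) (hD : b ^ 2 - 4 * a * c < 0) (τ : ℂ)
    (hτ : 0 < τ.im) (u v : ℂ) :
    (Summable fun p : ℤ × ℤ => (p.1 * u + p.2 * v) ^ 2 * thTerm a b c τ 0 0 p) ∧
    deriv (deriv (fun t => Th a b c τ (t * u) (t * v))) 0 =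
      (2 * Real.pi * Complex.I) ^ 2 * ∑' p : ℤ × ℤ, (p.1 * u + p.2 * v) ^ 2 * thTerm a b c τ 0 0 p := by
  obtain ⟨T, hT, h⟩ := thTerm_bound a b c ha hD τ hτ
  let R := max ‖u‖ ‖v‖
  have hbd : ∀ (p : ℤ × ℤ) (w : ℂ), w ∈ Metric.ball (0:ℂ) 1 →
      ‖thTerm a b c τ (w * u) (w * v) p‖ ≤ gbound T R p := by
    intro p w hw
    have hw : ‖w‖ ≤ 1 := by simpa using (mem_ball_zero_iff.1 hw).le
    refine h R _ _ ?_ ?_ p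
    · rw [norm_mul]
      exact (mul_le_of_le_one_left (norm_nonneg _) hw).trans (le_max_left _ _)
    · rw [norm_mul]
      exact (mul_le_of_le_one_left (norm_nonneg _) hw).trans (le_max_right _ _)
  have hder : ∀ p t, HasDerivAt (fun t => thTerm a b c τ (t * u) (t * v) p)
      (2 * Real.pi * Complex.I * (p.1 * u + p.2 * v) * thTerm a b c τ (t * u) (t * v) p) t := by
    intro p t
    simpa using thTerm_deriv a b c τ 0 0 u v p t
  have hlin : ∀ p : ℤ × ℤ, ‖2 * Real.pi * Complex.I * (p.1 * u + p.2 * v)‖ * gbound T R p ≤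
      2 * Real.pi * R * gbound T (R + 1) p := by
    intro p
    have h1 : ‖2 * Real.pi * Complex.I * (p.1 * u + p.2 * v)‖ ≤
        2 * Real.pi * R * (|(p.1:ℝ)| + |(p.2:ℝ)|) := by
      rw [norm_mul]
      have : ‖(2 * Real.pi * Complex.I : ℂ)‖ = 2 * Real.pi := by
        simp [abs_of_pos Real.pi_pos]
      rw [this]
      have h2 : ‖(p.1 * u + p.2 * v : ℂ)‖ ≤ R * (|(p.1:ℝ)| + |(p.2:ℝ)|) := by
        refine (norm_add_le _ _).trans ?_
        rw [norm_mul, norm_mul, Complex.norm_intCast, Complex.norm_intCast]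
        have := mul_le_mul_of_nonneg_left (le_max_left ‖u‖ ‖v‖) (abs_nonneg (p.1:ℝ))
        have := mul_le_mul_of_nonneg_left (le_max_right ‖u‖ ‖v‖) (abs_nonneg (p.2:ℝ))
        simp only [R]; linarith
      have := mul_le_mul_of_nonneg_left h2 (by positivity : 0 ≤ 2 * Real.pi)
      linarith
    have h3 : gbound T (R + 1) p = Real.exp (2 * Real.pi * (|(p.1:ℝ)| + |(p.2:ℝ)|)) * gbound T R p := by
      simp only [gbound, ← Real.exp_add]
      congr 1; ring
    have h4 : |(p.1:ℝ)| + |(p.2:ℝ)| ≤ Real.exp (2 * Real.pi * (|(p.1:ℝ)| + |(p.2:ℝ)|)) := by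
      refine le_trans ?_ (Real.add_one_le_exp _)
      have h0 : 0 ≤ |(p.1:ℝ)| + |(p.2:ℝ)| := by positivity
      nlinarith [Real.pi_gt_three]
    have hg : 0 ≤ gbound T R p := by unfold gbound; positivity
    have hR : 0 ≤ R := (norm_nonneg u).trans (le_max_left _ _)
    calc _ ≤ 2 * Real.pi * R * (|(p.1:ℝ)| + |(p.2:ℝ)|) * gbound T R p := by gcongr
      _ ≤ 2 * Real.pi * R * Real.exp (2 * Real.pi * (|(p.1:ℝ)| + |(p.2:ℝ)|)) * gbound T R p := by gcongr
      _ = _ := by rw [h3]; ring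
  have h1 : ∀ t ∈ Metric.ball (0:ℂ) 1, deriv (fun t => Th a b c τ (t * u) (t * v)) t =
      ∑' p : ℤ × ℤ, 2 * Real.pi * Complex.I * (p.1 * u + p.2 * v) * thTerm a b c τ (t * u) (t * v) p := by
    intro t ht
    have := Complex.hasSum_deriv_of_summable_norm (U := Metric.ball 0 1)
      (F := fun p t => thTerm a b c τ (t * u) (t * v) p) (gbound_summable hT R)
      (fun p w _ => (hder p w).differentiableAt.differentiableWithinAt) Metric.isOpen_ball hbd ht
    simp only [(hder _ _).deriv] at this
    exact this.tsum_eq.symm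
  have h2 := Complex.hasSum_deriv_of_summable_norm (U := Metric.ball 0 1) (z := 0)
      (F := fun (p : ℤ × ℤ) t => 2 * Real.pi * Complex.I * (p.1 * u + p.2 * v) * thTerm a b c τ (t * u) (t * v) p)
      ((gbound_summable hT (R + 1)).mul_left (2 * Real.pi * R))
      (fun p w _ => ((hder p w).const_mul _).differentiableAt.differentiableWithinAt) Metric.isOpen_ball
      (fun p w hw => by
        rw [norm_mul]
        exact (mul_le_mul_of_nonneg_left (hbd p w hw) (norm_nonneg _)).trans (hlin p)) (by simp)
  simp only [((hder _ _).const_mul _).deriv] at h2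
  have h3 : deriv (fun t => Th a b c τ (t * u) (t * v)) =ᶠ[𝓝 0] fun t =>
      ∑' p : ℤ × ℤ, 2 * Real.pi * Complex.I * (p.1 * u + p.2 * v) * thTerm a b c τ (t * u) (t * v) p := by
    filter_upwards [Metric.isOpen_ball.mem_nhds (by simp : (0:ℂ) ∈ Metric.ball (0:ℂ) 1)] with t ht
      using h1 t ht
  rw [h3.deriv_eq, ← h2.tsum_eq]
  have hne : (2 * Real.pi * Complex.I : ℂ) ^ 2 ≠ 0 := by
    simp [Real.pi_ne_zero]
  have hcongr : ∀ p : ℤ × ℤ, 2 * Real.pi * Complex.I * (p.1 * u + p.2 * v) *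
      (2 * Real.pi * Complex.I * (p.1 * u + p.2 * v) * thTerm a b c τ (0 * u) (0 * v) p) =
      (2 * Real.pi * Complex.I) ^ 2 * ((p.1 * u + p.2 * v) ^ 2 * thTerm a b c τ 0 0 p) := by
    intro p; rw [zero_mul, zero_mul]; ring
  have hs := h2.summable
  simp only [hcongr] at hs ⊢
  refine ⟨?_, tsum_mul_left⟩
  exact (summable_mul_left_iff hne).1 hs

/-- The parity decomposition `(n, m) = (k + l + σ, k - l)`. -/
def parityEquiv : (Fin 2 × Fin 2) × ((ℤ × ℤ) × (ℤ × ℤ)) ≃ (ℤ × ℤ) × (ℤ × ℤ) where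
  toFun z := ((z.2.1.1 + z.2.2.1 + ((z.1.1 : ℕ) : ℤ), z.2.1.2 + z.2.2.2 + ((z.1.2 : ℕ) : ℤ)),
    (z.2.1.1 - z.2.2.1, z.2.1.2 - z.2.2.2))
  invFun w := ((⟨((w.1.1 + w.2.1) % 2).toNat, by omega⟩, ⟨((w.1.2 + w.2.2) % 2).toNat, by omega⟩),
    (((w.1.1 + w.2.1) / 2, (w.1.2 + w.2.2) / 2), ((w.1.1 - w.2.1) / 2, (w.1.2 - w.2.2) / 2)))
  left_inv := by
    rintro ⟨⟨s, t⟩, ⟨k1, k2⟩, ⟨l1, l2⟩⟩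
    have hs := s.2
    have ht := t.2
    simp only [Prod.mk.injEq, Fin.ext_iff]
    refine ⟨⟨?_, ?_⟩, ⟨?_, ?_⟩, ⟨?_, ?_⟩⟩ <;> omega
  right_inv := by
    rintro ⟨⟨n1, n2⟩, ⟨m1, m2⟩⟩
    simp only [Prod.mk.injEq]
    refine ⟨⟨?_, ?_⟩, ⟨?_, ?_⟩⟩ <;> omega

/-- The shifted index `2k + σ`. -/
def shiftIdx (σ : Fin 2 × Fin 2) (k : ℤ × ℤ) : ℤ × ℤ :=
  (2 * k.1 + ((σ.1 : ℕ) : ℤ), 2 * k.2 + ((σ.2 : ℕ) : ℤ))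

lemma shiftIdx_inj (σ : Fin 2 × Fin 2) : Function.Injective (shiftIdx σ) := by
  rintro ⟨a, b⟩ ⟨c, d⟩ h
  simp only [shiftIdx, Prod.mk.injEq] at h ⊢
  omega

/-- Second order theta functions. -/
noncomputable def XX (a b c : ℤ) (τ : ℂ) (σ : Fin 2 × Fin 2) (x y : ℂ) : ℂ :=
  ∑' k, thTerm a b c (τ / 2) x y (shiftIdx σ k)

lemma Th_add (a b c : ℤ) (ha : 0 < a) (hD : b ^ 2 - 4 * a * c < 0) (τ : ℂ) (hτ : 0 < τ.im)
    (x y x' y' : ℂ) : Th a b c τ (x + x') (y + y') * Th a b c τ (x - x') (y - y') =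
      ∑ σ, XX a b c τ σ x y * XX a b c τ σ x' y' := by
  have hτ2 : 0 < (τ / 2).im := by
    have : (τ / 2).im = τ.im / 2 := by simp
    rw [this]; positivity
  have hs1 := thTerm_summable a b c ha hD τ hτ (x + x') (y + y')
  have hs2 := thTerm_summable a b c ha hD τ hτ (x - x') (y - y')
  have hX : ∀ x y σ, Summable fun k => ‖thTerm a b c (τ / 2) x y (shiftIdx σ k)‖ := fun x y σ =>
    (thTerm_summable a b c ha hD (τ / 2) hτ2 x y).comp_injective (shiftIdx_inj σ)
  unfold Th
  rw [tsum_mul_tsum_of_summable_norm hs1 hs2, ← parityEquiv.tsum_eq]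
  have hsum : Summable fun z : (ℤ × ℤ) × (ℤ × ℤ) => thTerm a b c τ (x + x') (y + y') z.1 *
      thTerm a b c τ (x - x') (y - y') z.2 := summable_mul_of_summable_norm hs1 hs2
  refine (Summable.tsum_prod ((parityEquiv.summable_iff).2 hsum)).trans ?_
  rw [tsum_fintype]
  refine Finset.sum_congr rfl fun σ _ => ?_
  unfold XX
  rw [tsum_mul_tsum_of_summable_norm (hX x y σ) (hX x' y' σ)]
  refine tsum_congr fun z => ?_
  simp only [thTerm, parityEquiv, shiftIdx, Function.comp_apply, Equiv.coe_fn_mk, ← Complex.exp_add]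
  congr 1
  push_cast
  ring

lemma Th_quasi (a b c : ℤ) (τ x y : ℂ) (v1 v2 w1 w2 : ℤ) (h : Th a b c τ x y = 0) :
    Th a b c τ (x + (τ * (2 * a * w1 + b * w2) + v1)) (y + (τ * (b * w1 + 2 * c * w2) + v2)) = 0 := by
  have : Th a b c τ (x + (τ * (2 * a * w1 + b * w2) + v1)) (y + (τ * (b * w1 + 2 * c * w2) + v2)) =
      Complex.exp (-(2 * Real.pi * Complex.I) * (τ * (a * w1 ^ 2 + b * w1 * w2 + c * w2 ^ 2)
        + (w1 * x + w2 * y))) * Th a b c τ x y := by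
    unfold Th
    rw [← (Equiv.addRight ((w1, w2) : ℤ × ℤ)).tsum_eq (thTerm a b c τ x y), ← tsum_mul_left]
    refine tsum_congr fun p => ?_
    simp only [thTerm, Equiv.coe_addRight, Prod.fst_add, Prod.snd_add, ← Complex.exp_add]
    rw [Complex.exp_eq_exp_iff_exists_int]
    refine ⟨p.1 * v1 + p.2 * v2, ?_⟩
    push_cast
    ring
  rw [this, h, mul_zero]

lemma Th_ne (a b c : ℤ) (ha : 0 < a) (hD : b ^ 2 - 4 * a * c < 0) (τ : ℂ) (hτ : 0 < τ.im) :
    ∃ x y, Th a b c τ x y ≠ 0 := by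
  by_contra! hcon
  have h1 : ∀ y : ℂ, ∑' p : ℤ × ℤ, (if p.1 = 0 then thTerm a b c τ 0 y p else 0) = 0 := by
    intro y
    refine fourier_avg (thTerm a b c τ 0 y) (thTerm_summable a b c ha hD τ hτ 0 y) Prod.fst fun t => ?_
    refine Eq.trans ?_ (hcon t y)
    rw [Th]
    refine tsum_congr fun p => ?_
    simp only [thTerm, ← Complex.exp_add]
    congr 1; ring
  have h2 := fourier_avg (fun p : ℤ × ℤ => if p.1 = 0 then thTerm a b c τ 0 0 p else 0)
    ((thTerm_summable a b c ha hD τ hτ 0 0).of_norm_bounded (fun p => by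
      split_ifs <;> simp)) Prod.snd fun t => ?_
  · rw [tsum_eq_single (0, 0)] at h2
    · simp [thTerm] at h2
    · rintro ⟨m, n⟩ hmn
      by_cases hn : n = 0
      · by_cases hm : m = 0
        · exact absurd (by rw [hm, hn]) hmn
        · simp [hm]
      · simp [hn]
  · refine Eq.trans ?_ (h1 t)
    refine tsum_congr fun p => ?_
    split_ifs
    · simp only [thTerm, ← Complex.exp_add]
      congr 1; ring
    · simp

lemma vanish_line (a b c : ℤ) (ha : 0 < a) (hD : b ^ 2 - 4 * a * c < 0) (τ : ℂ) (hτ : 0 < τ.im)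
    (h0 : Th a b c τ 0 0 = 0) (u v : ℂ)
    (hq : ∑' p : ℤ × ℤ, (p.1 * u + p.2 * v) ^ 2 * thTerm a b c τ 0 0 p = 0) (t : ℂ) :
    Th a b c τ (t * u) (t * v) = 0 := by
  set F : ℂ → ℂ := fun t => Th a b c τ (t * u) (t * v) with hFdef
  have hFd : Differentiable ℂ F := by
    simpa using Th_differentiable a b c ha hD τ hτ 0 0 u v
  have hFa : AnalyticOnNhd ℂ F Set.univ := fun z _ => hFd.analyticAt z
  obtain ⟨x, y, hxy⟩ := Th_ne a b c ha hD τ hτ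
  by_cases hev : ∀ᶠ z in 𝓝 (0:ℂ), F z = 0
  · have : F = fun _ => 0 := hFa.eq_of_eventuallyEq (z₀ := 0) analyticOnNhd_const hev
    exact congrFun this t
  · exfalso
    obtain ⟨m, g, hg, hg0, hFg⟩ := ((hFa 0 trivial).exists_eventuallyEq_pow_smul_nonzero_iff).2 hev
    simp only [sub_zero, smul_eq_mul] at hFg
    have h4 : 4 ≤ m := by
      refine order_ge (F := F) ?_ ?_ ?_ m g hg hg0 hFg
      · intro z
        simp only [hFdef, neg_mul]
        exact Th_neg _ _ _ _ _ _
      · simpa [hFdef] using h0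
      · rw [hFdef, (Th_deriv2 a b c ha hD τ hτ u v).2, hq, mul_zero]
    have h3 := rank_kernel (F := F) (G := fun t => Th a b c τ (x + t * u) (y + t * v))
      (fun σ t => XX a b c τ σ (x / 2 + t * u) (y / 2 + t * v))
      (fun σ t => XX a b c τ σ (x / 2 + t * u) (y / 2 + t * v))
      (Th_differentiable a b c ha hD τ hτ x y u v).continuous.continuousAt (by simpa using hxy)
      (fun t s => by
        rw [← Th_add a b c ha hD τ hτ]
        simp only [hFdef]
        congr 2 <;> ring) m g hg.continuousAt hg0 hFg
    omega

lemma theta_diag_ne (k : ℤ) (hk : 0 < k) (τ : ℂ) (hτ : 0 < τ.im)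
    (h : ∑' j : ℤ, Complex.exp (2 * Real.pi * Complex.I * (τ * (k * (j:ℂ) ^ 2))) = 0) : False := by
  set f : ℤ → ℂ := fun j => Complex.exp (2 * Real.pi * Complex.I * (τ * (k * (j:ℂ) ^ 2))) with hf
  have hD : (0:ℤ) ^ 2 - 4 * k * k < 0 := by nlinarith
  have hterm : ∀ p : ℤ × ℤ, thTerm k 0 k τ 0 0 p = f p.1 * f p.2 := by
    intro p
    simp only [thTerm, hf, ← Complex.exp_add]
    congr 1; push_cast; ring
  have hsum := (thTerm_summable k 0 k hk hD τ hτ 0 0).of_norm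
  have h10 := (Th_deriv2 k 0 k hk hD τ hτ 1 0).1
  have h01 := (Th_deriv2 k 0 k hk hD τ hτ 0 1).1
  have z10 : ∑' p : ℤ × ℤ, ((p.1:ℂ) * 1 + p.2 * 0) ^ 2 * thTerm k 0 k τ 0 0 p = 0 := by
    rw [h10.tsum_prod]
    have : ∀ m : ℤ, ∑' n : ℤ, ((m:ℂ) * 1 + n * 0) ^ 2 * thTerm k 0 k τ 0 0 (m, n) = 0 := by
      intro m
      have e : ∀ n : ℤ, ((m:ℂ) * 1 + n * 0) ^ 2 * thTerm k 0 k τ 0 0 (m, n) = m ^ 2 * f m * f n := by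
        intro n; rw [hterm]; simp only; ring
      simp only [e]
      rw [tsum_mul_left, h, mul_zero]
    simp only [this, tsum_zero]
  have hsw : ∀ p : ℤ × ℤ, thTerm k 0 k τ 0 0 p.swap = thTerm k 0 k τ 0 0 p := by
    intro p; rw [hterm, hterm]; simp [mul_comm]
  have z01 : ∑' p : ℤ × ℤ, ((p.1:ℂ) * 0 + p.2 * 1) ^ 2 * thTerm k 0 k τ 0 0 p = 0 := by
    refine Eq.trans ?_ z10
    rw [← (Equiv.prodComm ℤ ℤ).tsum_eq]
    refine tsum_congr fun p => ?_
    simp only [Equiv.prodComm_apply, hsw, Prod.fst_swap, Prod.snd_swap]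
    ring
  have h0 : Th k 0 k τ 0 0 = 0 := by
    unfold Th
    rw [hsum.tsum_prod]
    have : ∀ m : ℤ, ∑' n : ℤ, thTerm k 0 k τ 0 0 (m, n) = 0 := by
      intro m
      simp only [hterm]
      rw [tsum_mul_left, h, mul_zero]
    simp only [this, tsum_zero]
  have hall : ∀ u v : ℂ, ∑' p : ℤ × ℤ, ((p.1:ℂ) * u + p.2 * v) ^ 2 * thTerm k 0 k τ 0 0 p = 0 := by
    intro u v
    have s1 := (Th_deriv2 k 0 k hk hD τ hτ u v).1
    have s2 := (Th_deriv2 k 0 k hk hD τ hτ u (-v)).1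
    have e1 : ∑' p : ℤ × ℤ, ((p.1:ℂ) * u + p.2 * (-v)) ^ 2 * thTerm k 0 k τ 0 0 p =
        ∑' p : ℤ × ℤ, ((p.1:ℂ) * u + p.2 * v) ^ 2 * thTerm k 0 k τ 0 0 p := by
      rw [← ((Equiv.refl ℤ).prodCongr (Equiv.neg ℤ)).tsum_eq]
      refine tsum_congr fun p => ?_
      have : thTerm k 0 k τ 0 0 (p.1, -p.2) = thTerm k 0 k τ 0 0 p := by
        simp [thTerm]
      simp only [Equiv.prodCongr_apply, Prod.map, Equiv.refl_apply, Equiv.neg_apply, this]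
      push_cast; ring
    have e2 := s1.tsum_add s2
    have e3 : ∑' p : ℤ × ℤ, (((p.1:ℂ) * u + p.2 * v) ^ 2 * thTerm k 0 k τ 0 0 p +
        ((p.1:ℂ) * u + p.2 * (-v)) ^ 2 * thTerm k 0 k τ 0 0 p) = 0 := by
      have e4 := (h10.mul_left (2 * u ^ 2)).tsum_add (h01.mul_left (2 * v ^ 2))
      rw [tsum_mul_left, tsum_mul_left, z10, z01, mul_zero, mul_zero, add_zero] at e4
      refine Eq.trans ?_ e4
      refine tsum_congr fun p => ?_
      ring
    rw [e1, e3] at e2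
    linear_combination -e2 / 2
  obtain ⟨x, y, hxy⟩ := Th_ne k 0 k hk hD τ hτ
  apply hxy
  simpa using vanish_line k 0 k hk hD τ hτ h0 x y (hall x y) 1

lemma Th_rational (a b c : ℤ) (ha : 0 < a) (hD : b ^ 2 - 4 * a * c < 0) (τ : ℂ) (hτ : 0 < τ.im)
    (v1 v2 : ℤ) (hv : ¬ (v1 = 0 ∧ v2 = 0)) (h : ∀ t : ℂ, Th a b c τ (t * v1) (t * v2) = 0) :
    False := by
  have h1 := fourier_avg (thTerm a b c τ 0 0) (thTerm_summable a b c ha hD τ hτ 0 0)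
    (fun p => p.1 * v1 + p.2 * v2) (fun t => by
      refine Eq.trans ?_ (h t)
      rw [Th]
      refine tsum_congr fun p => ?_
      simp only [thTerm, ← Complex.exp_add]
      congr 1; push_cast; ring)
  have hg : 0 < Int.gcd v1 v2 := Int.gcd_pos_iff.2 (by tauto)
  obtain ⟨w1, w2, hcop, e1, e2⟩ := Int.exists_gcd_one hg
  have hg' : (Int.gcd v1 v2 : ℤ) ≠ 0 := by exact_mod_cast hg.ne'
  have hw : ¬ (w1 = 0 ∧ w2 = 0) := by
    rintro ⟨rfl, rfl⟩
    simp at hcop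
  have hcop' : IsCoprime w1 w2 := Int.isCoprime_iff_gcd_eq_one.2 hcop
  let ι : ℤ → ℤ × ℤ := fun j => (j * w2, -(j * w1))
  have hinj : Function.Injective ι := by
    intro i j hij
    simp only [ι, Prod.mk.injEq, neg_inj] at hij
    by_contra hne
    apply hw
    have hne' : i - j ≠ 0 := sub_ne_zero.2 hne
    refine ⟨?_, ?_⟩
    · exact (mul_eq_zero.1 (show (i - j) * w1 = 0 by linear_combination hij.2)).resolve_left hne'
    · exact (mul_eq_zero.1 (show (i - j) * w2 = 0 by linear_combination hij.1)).resolve_left hne'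
  have hsupp : Function.support (fun p : ℤ × ℤ =>
      if p.1 * v1 + p.2 * v2 = 0 then thTerm a b c τ 0 0 p else 0) ⊆ Set.range ι := by
    rintro ⟨m, n⟩ hp
    have hmn : m * v1 + n * v2 = 0 := by
      by_contra hne
      simp [hne] at hp
    have hmn' : m * w1 + n * w2 = 0 := by
      have : (m * w1 + n * w2) * (Int.gcd v1 v2 : ℤ) = 0 := by
        linear_combination hmn - m * e1 - n * e2
      exact (mul_eq_zero.1 this).resolve_right hg'
    have hdvd : w2 ∣ m := by
      refine hcop'.symm.dvd_of_dvd_mul_right (⟨-n, by linear_combination hmn'⟩ : w2 ∣ m * w1)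
    obtain ⟨r, s, hrs⟩ := hcop'
    refine ⟨m * s - n * r, ?_⟩
    simp only [ι, Prod.mk.injEq]
    constructor
    · linear_combination (-r) * hmn' + m * hrs
    · linear_combination (-s) * hmn' + n * hrs
  have hA : ∀ j : ℤ, thTerm a b c τ 0 0 (ι j) = Complex.exp (2 * Real.pi * Complex.I *
      (τ * (((a * w2 ^ 2 - b * w1 * w2 + c * w1 ^ 2 : ℤ) : ℂ) * (j:ℂ) ^ 2))) := by
    intro j
    simp only [thTerm, ι]
    congr 1; push_cast; ring
  have hkpos : 0 < a * w2 ^ 2 - b * w1 * w2 + c * w1 ^ 2 := by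
    by_contra hle
    push Not at hle
    have h4 : 4 * a * (a * w2 ^ 2 - b * w1 * w2 + c * w1 ^ 2) ≤ 0 := by nlinarith
    have h5 : (2 * a * w2 - b * w1) ^ 2 + (4 * a * c - b ^ 2) * w1 ^ 2 ≤ 0 := by nlinarith
    have h6 : w1 = 0 := by
      by_contra hne
      have : 0 < w1 ^ 2 := by positivity
      nlinarith [sq_nonneg (2 * a * w2 - b * w1)]
    subst h6
    have h7 : w2 = 0 := by
      by_contra hne
      have : 0 < w2 ^ 2 := by positivity
      nlinarith
    exact hw ⟨rfl, h7⟩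
  refine theta_diag_ne _ hkpos τ hτ ?_
  rw [← hinj.tsum_eq hsupp] at h1
  refine Eq.trans (tsum_congr fun j => ?_) h1
  have : (ι j).1 * v1 + (ι j).2 * v2 = 0 := by
    simp only [ι]
    linear_combination (j * w2) * e1 - (j * w1) * e2
  rw [if_pos this, hA]

lemma exists_isotropic (a b c : ℤ) (ha : 0 < a) (hD : b ^ 2 - 4 * a * c < 0) (τ : ℂ)
    (hτ : 0 < τ.im) : ∃ u v : ℂ, ¬ (u = 0 ∧ v = 0) ∧
    ∑' p : ℤ × ℤ, (p.1 * u + p.2 * v) ^ 2 * thTerm a b c τ 0 0 p = 0 := by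
  have h10 := (Th_deriv2 a b c ha hD τ hτ 1 0).1.hasSum
  have h01 := (Th_deriv2 a b c ha hD τ hτ 0 1).1.hasSum
  have h11 := (Th_deriv2 a b c ha hD τ hτ 1 1).1.hasSum
  set α := ∑' p : ℤ × ℤ, ((p.1:ℂ) * 1 + p.2 * 0) ^ 2 * thTerm a b c τ 0 0 p with hα
  set γ := ∑' p : ℤ × ℤ, ((p.1:ℂ) * 0 + p.2 * 1) ^ 2 * thTerm a b c τ 0 0 p
  set β := ∑' p : ℤ × ℤ, ((p.1:ℂ) * 1 + p.2 * 1) ^ 2 * thTerm a b c τ 0 0 p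
  by_cases h : α = 0
  · exact ⟨1, 0, by simp, by rw [← hα, h]⟩
  · obtain ⟨u, hu⟩ := exists_quadratic_eq_zero (a := α) (b := β - α - γ) (c := γ) h
      (IsAlgClosed.exists_eq_mul_self _)
    refine ⟨u, 1, by simp, ?_⟩
    have := (((h10.mul_left (u * u)).add (((h11.sub h10).sub h01).mul_left u)).add h01).tsum_eq
    refine Eq.trans (tsum_congr fun p => ?_) (this.trans ?_)
    · ring
    · linear_combination hu

lemma parallel_of_det {u v p q : ℂ} (huv : ¬ (u = 0 ∧ v = 0)) (h : v * p = u * q) :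
    ∃ s : ℂ, p = s * u ∧ q = s * v := by
  by_cases hu : u = 0
  · have hv : v ≠ 0 := fun hv => huv ⟨hu, hv⟩
    subst hu
    refine ⟨q / v, ?_, by field_simp⟩
    have : v * p = 0 := by linear_combination h
    rw [mul_zero]
    exact (mul_eq_zero.1 this).resolve_left hv
  · refine ⟨p / u, by field_simp, ?_⟩
    field_simp
    linear_combination -h

lemma int_rank (L : (Fin 4 → ℤ) →ₗ[ℤ] ℂ) (ε : ℝ) (hε : 0 < ε)
    (h : ∀ z, L z ≠ 0 → ε ≤ ‖L z‖) :
    ∃ z z' : Fin 4 → ℤ, L z = 0 ∧ L z' = 0 ∧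
      ∀ α β : ℤ, α • z + β • z' = 0 → α = 0 ∧ β = 0 := by
  have hspan : Submodule.span ℤ (LinearMap.range L : Set ℂ) = LinearMap.range L :=
    Submodule.span_eq _
  have hdisc : DiscreteTopology (Submodule.span ℤ (LinearMap.range L : Set ℂ)) := by
    rw [hspan]
    rw [discreteTopology_iff_isOpen_singleton_zero, Metric.isOpen_singleton_iff]
    refine ⟨ε, hε, ?_⟩
    rintro ⟨y, z, rfl⟩ hy
    by_contra hne
    have hz : L z ≠ 0 := fun h0 => hne (Subtype.ext h0)
    have h1 := h z hz
    rw [dist_eq_norm, sub_zero] at hy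
    exact absurd hy (not_lt.2 h1)
  have h1 := Real.finrank_eq_int_finrank_of_discrete hdisc
  have h2 : Set.finrank ℝ (LinearMap.range L : Set ℂ) ≤ 2 := by
    have := Submodule.finrank_le (Submodule.span ℝ (LinearMap.range L : Set ℂ))
    rwa [Complex.finrank_real_complex] at this
  have h3 : Module.finrank ℤ (LinearMap.range L) ≤ 2 := by
    rw [h1, Set.finrank, hspan] at h2
    exact h2
  have h4 := Submodule.finrank_quotient_add_finrank (LinearMap.ker L)
  rw [L.quotKerEquivRange.finrank_eq, Module.finrank_fin_fun] at h4
  obtain ⟨f, hf⟩ := exists_linearIndependent_of_le_finrank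
    (show 2 ≤ Module.finrank ℤ (LinearMap.ker L) by omega)
  refine ⟨f 0, f 1, (f 0).2, (f 1).2, fun α β hαβ => ?_⟩
  have hp := LinearIndependent.pair_iff.1 (show LinearIndependent ℤ ![f 0, f 1] by
    convert hf using 1
    ext i : 1
    fin_cases i <;> rfl)
  exact hp α β (Subtype.ext hαβ)

lemma discrete_gap (a b c : ℤ) (ha : 0 < a) (hD : b ^ 2 - 4 * a * c < 0) (τ : ℂ)
    (hτ : 0 < τ.im) (u v : ℂ) (huv : ¬ (u = 0 ∧ v = 0))
    (hl : ∀ t : ℂ, Th a b c τ (t * u) (t * v) = 0) :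
    ∃ ε : ℝ, 0 < ε ∧ ∀ v1 v2 w1 w2 : ℤ,
      v * (τ * (2 * a * w1 + b * w2) + v1) - u * (τ * (b * w1 + 2 * c * w2) + v2) ≠ 0 →
      ε ≤ ‖v * (τ * (2 * a * w1 + b * w2) + v1) - u * (τ * (b * w1 + 2 * c * w2) + v2)‖ := by
  by_contra hcon
  push Not at hcon
  obtain ⟨x, y, hxy⟩ := Th_ne a b c ha hD τ hτ
  obtain ⟨x1, y1, h1⟩ : ∃ x1 y1 : ℂ, v * x1 - u * y1 = 1 := by
    by_cases hu : u = 0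
    · have hv : v ≠ 0 := fun hv => huv ⟨hu, hv⟩
      exact ⟨1 / v, 0, by field_simp; ring⟩
    · exact ⟨0, -1 / u, by field_simp; ring⟩
  set l : ℂ := v * x - u * y with hl'
  have hdiff := Th_differentiable a b c ha hD τ hτ (x - l * x1) (y - l * y1) x1 y1
  have han : AnalyticOnNhd ℂ (fun t => Th a b c τ (x - l * x1 + t * x1) (y - l * y1 + t * y1))
      Set.univ := fun t _ => hdiff.analyticAt t
  have hz0 : AnalyticOnNhd ℂ (fun _ : ℂ => (0:ℂ)) Set.univ := fun t _ => analyticAt_const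
  have hfreq : ∃ᶠ t in 𝓝[≠] (0:ℂ),
      Th a b c τ (x - l * x1 + t * x1) (y - l * y1 + t * y1) = 0 := by
    rw [frequently_iff]
    intro U hU
    rw [Metric.mem_nhdsWithin_iff] at hU
    obtain ⟨ε, hε, hsub⟩ := hU
    obtain ⟨v1, v2, w1, w2, hne, hlt⟩ := hcon ε hε
    set X : ℂ := τ * (2 * a * w1 + b * w2) + v1 with hX
    set Y : ℂ := τ * (b * w1 + 2 * c * w2) + v2 with hY
    refine ⟨v * X - u * Y, hsub ⟨by simpa using hlt, hne⟩, ?_⟩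
    obtain ⟨s, hs1, hs2⟩ := parallel_of_det (p := x - l * x1 + (v * X - u * Y) * x1 - X)
      (q := y - l * y1 + (v * X - u * Y) * y1 - Y) huv (by
        linear_combination (v * X - u * Y - l) * h1 - hl')
    have := Th_quasi a b c τ (s * u) (s * v) v1 v2 w1 w2 (hl s)
    rw [← hX, ← hY, ← hs1, ← hs2] at this
    simpa using this
  have heq := han.eq_of_frequently_eq hz0 hfreq
  have := congrFun heq l
  apply hxy
  simpa using this

lemma disc_neg (P B C : ℤ) (hP : P ≠ 0) (τ : ℂ) (hτ : 0 < τ.im)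
    (h : (P : ℂ) * τ ^ 2 + (B : ℂ) * τ + (C : ℂ) = 0) : B ^ 2 - 4 * P * C < 0 := by
  have h1 : (2 * P * τ + B) ^ 2 = ((B ^ 2 - 4 * P * C : ℤ) : ℂ) := by
    push_cast
    linear_combination 4 * P * h
  set w : ℂ := 2 * P * τ + B with hw
  have hre := congrArg Complex.re h1
  have him := congrArg Complex.im h1
  rw [Complex.intCast_re, sq, Complex.mul_re] at hre
  rw [Complex.intCast_im, sq, Complex.mul_im] at him
  have hwim : w.im = 2 * P * τ.im := by
    simp [hw]
  have hPr : (P : ℝ) ≠ 0 := by exact_mod_cast hP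
  have hwne : w.im ≠ 0 := by rw [hwim]; positivity
  have hwre : w.re = 0 := by
    have : w.re * w.im = 0 := by linarith
    exact (mul_eq_zero.1 this).resolve_right hwne
  rw [hwre] at hre
  have : ((B ^ 2 - 4 * P * C : ℤ) : ℝ) < 0 := by
    rw [← hre]
    have := mul_self_pos.2 hwne
    linarith
  exact_mod_cast this

/-- Linear form cutting out the zero direction, on the period lattice. -/
noncomputable def perL (a b c : ℤ) (τ u v : ℂ) : (Fin 4 → ℤ) →ₗ[ℤ] ℂ :=
  AddMonoidHom.toIntLinearMap
  { toFun := fun z => v * (τ * (2 * a * z 2 + b * z 3) + z 0) - u * (τ * (b * z 2 + 2 * c * z 3) + z 1)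
    map_zero' := by simp
    map_add' := by
      intro z z'
      simp only [Pi.add_apply]
      push_cast
      ring }

lemma perL_apply (a b c : ℤ) (τ u v : ℂ) (z : Fin 4 → ℤ) : perL a b c τ u v z =
    v * (τ * (2 * a * z 2 + b * z 3) + z 0) - u * (τ * (b * z 2 + 2 * c * z 3) + z 1) := rfl

lemma thetaA_eq (a b c : ℤ) (τ : ℂ) : thetaA a b c τ = Th a b c τ 0 0 := by
  unfold thetaA Th
  refine tsum_congr fun p => ?_
  rw [qq, ← Complex.exp_int_mul, thTerm]
  congr 1; push_cast; ring

lemma no_w_zero (a b c : ℤ) (ha : 0 < a) (hD : b ^ 2 - 4 * a * c < 0) (τ : ℂ)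
    (hτ : 0 < τ.im) (u v : ℂ) (huv : ¬ (u = 0 ∧ v = 0))
    (hl : ∀ t : ℂ, Th a b c τ (t * u) (t * v) = 0) (z : Fin 4 → ℤ)
    (hz : perL a b c τ u v z = 0) (h2 : z 2 = 0) (h3 : z 3 = 0) : z = 0 := by
  by_contra hne
  rw [perL_apply, h2, h3] at hz
  obtain ⟨s, hs1, hs2⟩ := parallel_of_det (p := (z 0 : ℂ)) (q := (z 1 : ℂ)) huv (by
    push_cast at hz
    linear_combination hz)
  refine Th_rational a b c ha hD τ hτ (z 0) (z 1) ?_ fun t => ?_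
  · rintro ⟨h0, h1⟩
    apply hne
    ext i
    fin_cases i
    · exact h0
    · exact h1
    · exact h2
    · exact h3
  · rw [hs1, hs2, ← mul_assoc, ← mul_assoc]
    exact hl _

/-- Zeros of binary theta functions are imaginary quadratic irrationalities. -/
theorem binary_theta_zeros_are_CM (a b c : ℤ) (ha : 0 < a)
    (hD : b ^ 2 - 4 * a * c < 0) (τ₀ : ℂ) (hτ₀ : 0 < τ₀.im)
    (hzero : thetaA a b c τ₀ = 0) :
    ∃ P B C : ℤ, 0 < P ∧ B ^ 2 - 4 * P * C < 0 ∧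
      (P : ℂ) * τ₀ ^ 2 + (B : ℂ) * τ₀ + (C : ℂ) = 0 := by
  rw [thetaA_eq] at hzero
  obtain ⟨u, v, huv, hq⟩ := exists_isotropic a b c ha hD τ₀ hτ₀
  have hl : ∀ t : ℂ, Th a b c τ₀ (t * u) (t * v) = 0 :=
    vanish_line a b c ha hD τ₀ hτ₀ hzero u v hq
  obtain ⟨ε, hε, hgap⟩ := discrete_gap a b c ha hD τ₀ hτ₀ u v huv hl
  obtain ⟨z, z', hz, hz', hind⟩ := int_rank (perL a b c τ₀ u v) ε hε
    (fun z hz => hgap (z 0) (z 1) (z 2) (z 3) hz)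
  have e1 := hz
  have e2 := hz'
  rw [perL_apply] at e1 e2
  obtain ⟨s, hs1, hs2⟩ := parallel_of_det huv (sub_eq_zero.1 e1)
  obtain ⟨s', hs1', hs2'⟩ := parallel_of_det huv (sub_eq_zero.1 e2)
  set d : ℤ := z 2 * z' 3 - z' 2 * z 3 with hd
  obtain ⟨P, hP⟩ : ∃ P : ℤ, P = (4 * a * c - b ^ 2) * d := ⟨_, rfl⟩
  obtain ⟨B, hB⟩ : ∃ B : ℤ, B = (2 * a * z 2 + b * z 3) * z' 1 + z 0 * (b * z' 2 + 2 * c * z' 3)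
    - (2 * a * z' 2 + b * z' 3) * z 1 - z' 0 * (b * z 2 + 2 * c * z 3) := ⟨_, rfl⟩
  obtain ⟨C, hC⟩ : ∃ C : ℤ, C = z 0 * z' 1 - z' 0 * z 1 := ⟨_, rfl⟩
  have hmain : (P : ℂ) * τ₀ ^ 2 + (B : ℂ) * τ₀ + (C : ℂ) = 0 := by
    have hdet : (τ₀ * (2 * a * z 2 + b * z 3) + z 0) * (τ₀ * (b * z' 2 + 2 * c * z' 3) + z' 1)
      - (τ₀ * (2 * a * z' 2 + b * z' 3) + z' 0) * (τ₀ * (b * z 2 + 2 * c * z 3) + z 1) = 0 := by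
      rw [hs1, hs2, hs1', hs2']; ring
    rw [hP, hB, hC, hd]
    push_cast
    linear_combination hdet
  have hd0 : d ≠ 0 := by
    intro hd0
    have key : ∀ α β : ℤ, α * z 2 + β * z' 2 = 0 → α * z 3 + β * z' 3 = 0 → α = 0 ∧ β = 0 := by
      intro α β h2 h3
      apply hind
      refine no_w_zero a b c ha hD τ₀ hτ₀ u v huv hl _ ?_ ?_ ?_
      · rw [map_add, map_smul, map_smul, hz, hz', smul_zero, smul_zero, add_zero]
      · simpa using h2
      · simpa using h3
    obtain ⟨-, h2⟩ := key (z' 2) (-z 2) (by ring) (by rw [hd] at hd0; linear_combination -hd0)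
    obtain ⟨-, h3⟩ := key (z' 3) (-z 3) (by rw [hd] at hd0; linear_combination hd0) (by ring)
    have h2' : z 2 = 0 := by omega
    have h3' : z 3 = 0 := by omega
    have := key 1 0 (by simp [h2']) (by simp [h3'])
    simp at this
  have hP0 : P ≠ 0 := by
    rw [hP]
    exact mul_ne_zero (by intro h; linarith) hd0
  have hdisc := disc_neg P B C hP0 τ₀ hτ₀ hmain
  rcases lt_or_gt_of_ne hP0 with h | h
  · refine ⟨-P, -B, -C, by omega, by nlinarith, ?_⟩
    push_cast
    linear_combination -hmain
  · exact ⟨P, B, C, h, hdisc, hmain⟩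
end

section
/- Let m ≥ 1 and let a, c, b₁, …, b_m be integers. Then the exponential sum S = ∑_{α=0}^{3} ∑_{γ=0}^{3} ∑_{(β₁,…,β_m)∈{0,1}^m} exp(2πi( (αc + γa)/4 − (β₁b₁ + ⋯ + β_m b_m)/2 − αγ/2 + (β₁ + ⋯ + β_m)/2 )) satisfies: S = −2^{m+3} if a ≡ 2 (mod 4), c ≡ 2 (mod 4) and all bⱼ are odd; S = 2^{m+3} if a and c are both even, all bⱼ are odd, and it is not the case that a ≡ 2 and c ≡ 2 (mod 4); and S = 0 in all other cases. -/
open scoped BigOperators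

/-- The Weil representation character sum
`S = ∑_{α=0}^{3} ∑_{γ=0}^{3} ∑_{(β₁,…,β_m) ∈ {0,1}^m}
  exp(2πi((αc + γa)/4 − (β₁b₁+⋯+β_m b_m)/2 − αγ/2 + (β₁+⋯+β_m)/2))`. -/
noncomputable def weilSum (m : ℕ) (a c : ℤ) (b : Fin m → ℤ) : ℂ :=
  ∑ α ∈ Finset.range 4, ∑ γ ∈ Finset.range 4, ∑ β : Fin m → Fin 2,
    Complex.exp (2 * Real.pi * Complex.I *
      ((((α : ℝ) * (c : ℝ) + (γ : ℝ) * (a : ℝ)) / 4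
        - (∑ j, ((β j : ℕ) : ℝ) * ((b j : ℝ))) / 2
        - (α : ℝ) * (γ : ℝ) / 2
        + (∑ j, ((β j : ℕ) : ℝ)) / 2 : ℝ)))

theorem weil_term (m : ℕ) (a c : ℤ) (b : Fin m → ℤ) (α γ : ℕ) (β : Fin m → Fin 2) :
    Complex.exp (2 * Real.pi * Complex.I *
      ((((α : ℝ) * (c : ℝ) + (γ : ℝ) * (a : ℝ)) / 4
        - (∑ j, ((β j : ℕ) : ℝ) * ((b j : ℝ))) / 2
        - (α : ℝ) * (γ : ℝ) / 2
        + (∑ j, ((β j : ℕ) : ℝ)) / 2 : ℝ))) =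
    ((Complex.I ^ c) ^ α * (Complex.I ^ a) ^ γ * (-1) ^ (α * γ)) *
      ∏ j, ((-1 : ℂ) ^ (1 - b j)) ^ (β j : ℕ) := by
  have hI : Complex.I = Complex.exp (Real.pi / 2 * Complex.I) := Complex.exp_pi_div_two_mul_I.symm
  have hneg : (-1 : ℂ) = Complex.exp (Real.pi * Complex.I) := Complex.exp_pi_mul_I.symm
  have hneg' : (-1 : ℂ) = Complex.exp (-(Real.pi * Complex.I)) := by
    rw [Complex.exp_neg, Complex.exp_pi_mul_I]; norm_num
  have h1 : ∀ (n : ℤ) (k : ℕ),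
      (Complex.I ^ n) ^ k = Complex.exp (k * (n * (Real.pi / 2 * Complex.I))) := by
    intro n k
    rw [Complex.exp_nat_mul, Complex.exp_int_mul, ← hI]
  have h2 : ∀ (n : ℤ) (k : ℕ),
      ((-1 : ℂ) ^ n) ^ k = Complex.exp (k * (n * (Real.pi * Complex.I))) := by
    intro n k
    rw [Complex.exp_nat_mul, Complex.exp_int_mul, ← hneg]
  have h3 : ∀ k : ℕ, (-1 : ℂ) ^ k = Complex.exp (k * (-(Real.pi * Complex.I))) := by
    intro k
    rw [Complex.exp_nat_mul, ← hneg']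
  rw [h1, h1, h3]
  simp_rw [h2]
  rw [← Complex.exp_sum, ← Complex.exp_add, ← Complex.exp_add, ← Complex.exp_add]
  congr 1
  have h4 : ∑ j, ((β j : ℕ) : ℂ) * (((1 - b j : ℤ) : ℂ) * (Real.pi * Complex.I)) =
      (∑ j, ((β j : ℕ) : ℂ) - ∑ j, ((β j : ℕ) : ℂ) * (b j : ℂ)) * (Real.pi * Complex.I) := by
    rw [← Finset.sum_sub_distrib, Finset.sum_mul]
    refine Finset.sum_congr rfl fun j _ => ?_
    push_cast
    ring
  rw [h4]
  push_cast
  ring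

theorem weilSum_factor (m : ℕ) (a c : ℤ) (b : Fin m → ℤ) :
    weilSum m a c b =
      (∑ α ∈ Finset.range 4, ∑ γ ∈ Finset.range 4,
        (Complex.I ^ c) ^ α * (Complex.I ^ a) ^ γ * (-1) ^ (α * γ)) *
      ∏ j, (1 + (-1 : ℂ) ^ (1 - b j)) := by
  have hp : ∏ j, (1 + (-1 : ℂ) ^ (1 - b j)) =
      ∑ β : Fin m → Fin 2, ∏ j, ((-1 : ℂ) ^ (1 - b j)) ^ (β j : ℕ) := by
    rw [← Fintype.prod_sum (fun j (k : Fin 2) => ((-1 : ℂ) ^ (1 - b j)) ^ (k : ℕ))]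
    simp [Fin.sum_univ_two]
  unfold weilSum
  simp_rw [weil_term, ← Finset.mul_sum, ← hp, ← Finset.sum_mul]

theorem I_zpow_mod (n : ℤ) : Complex.I ^ n = Complex.I ^ (n % 4) := by
  conv_lhs => rw [← Int.emod_add_mul_ediv n 4]
  rw [zpow_add₀ Complex.I_ne_zero, zpow_mul]
  have : Complex.I ^ (4 : ℤ) = 1 := by exact_mod_cast Complex.I_pow_four
  rw [this, one_zpow, mul_one]

theorem I_zpow_cases (n : ℤ) :
    (n % 4 = 0 ∧ Complex.I ^ n = 1) ∨ (n % 4 = 1 ∧ Complex.I ^ n = Complex.I) ∨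
    (n % 4 = 2 ∧ Complex.I ^ n = -1) ∨ (n % 4 = 3 ∧ Complex.I ^ n = -Complex.I) := by
  have h2 : Complex.I ^ (2 : ℤ) = -1 := by exact_mod_cast Complex.I_sq
  have h3 : Complex.I ^ (3 : ℤ) = -Complex.I := by exact_mod_cast Complex.I_pow_three
  have h : n % 4 = 0 ∨ n % 4 = 1 ∨ n % 4 = 2 ∨ n % 4 = 3 := by omega
  rw [I_zpow_mod n]
  rcases h with h | h | h | h <;> rw [h] <;> simp [h2, h3]

theorem prod_odd (m : ℕ) (b : Fin m → ℤ) (h : ∀ j, Odd (b j)) :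
    ∏ j, (1 + (-1 : ℂ) ^ (1 - b j)) = 2 ^ m := by
  have : ∀ j, (1 + (-1 : ℂ) ^ (1 - b j)) = 2 := fun j => by
    rw [Even.neg_one_zpow (odd_one.sub_odd (h j))]; norm_num
  simp [this]

theorem prod_not_odd (m : ℕ) (b : Fin m → ℤ) (h : ¬ ∀ j, Odd (b j)) :
    ∏ j, (1 + (-1 : ℂ) ^ (1 - b j)) = 0 := by
  push Not at h
  obtain ⟨j, hj⟩ := h
  refine Finset.prod_eq_zero (Finset.mem_univ j) ?_
  rw [Odd.neg_one_zpow (odd_one.sub_even (Int.not_odd_iff_even.mp hj))]; norm_num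

theorem quad_sum (a c : ℤ) :
    (∑ α ∈ Finset.range 4, ∑ γ ∈ Finset.range 4,
        (Complex.I ^ c) ^ α * (Complex.I ^ a) ^ γ * (-1) ^ (α * γ)) =
      if Even a ∧ Even c then (if a % 4 = 2 ∧ c % 4 = 2 then -8 else 8) else 0 := by
  have hI3 := Complex.I_pow_three
  have hI2 := Complex.I_sq
  simp only [Int.even_iff]
  rcases I_zpow_cases a with ⟨ha, ha'⟩ | ⟨ha, ha'⟩ | ⟨ha, ha'⟩ | ⟨ha, ha'⟩ <;>
  rcases I_zpow_cases c with ⟨hc, hc'⟩ | ⟨hc, hc'⟩ | ⟨hc, hc'⟩ | ⟨hc, hc'⟩ <;>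
  rw [ha', hc', ha, hc] <;>
  [rw [if_pos (by omega)]; rw [if_neg (by omega)]; rw [if_pos (by omega)]; rw [if_neg (by omega)];
   rw [if_neg (by omega)]; rw [if_neg (by omega)]; rw [if_neg (by omega)]; rw [if_neg (by omega)];
   rw [if_pos (by omega)]; rw [if_neg (by omega)]; rw [if_pos (by omega)]; rw [if_neg (by omega)];
   rw [if_neg (by omega)]; rw [if_neg (by omega)]; rw [if_neg (by omega)]; rw [if_neg (by omega)]] <;>
  simp only [Finset.sum_range_succ, Finset.sum_range_zero] <;>
  norm_num <;> grind

theorem weil_character_sum_evaluation (m : ℕ) (hm : 1 ≤ m) (a c : ℤ) (b : Fin m → ℤ) :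
    ((a % 4 = 2 ∧ c % 4 = 2 ∧ ∀ j, Odd (b j)) →
      weilSum m a c b = -(2 ^ (m + 3) : ℂ)) ∧
    ((Even a ∧ Even c ∧ (∀ j, Odd (b j)) ∧ ¬(a % 4 = 2 ∧ c % 4 = 2)) →
      weilSum m a c b = (2 ^ (m + 3) : ℂ)) ∧
    (¬(Even a ∧ Even c ∧ ∀ j, Odd (b j)) → weilSum m a c b = 0) := by
  have hq := quad_sum a c
  refine ⟨?_, ?_, ?_⟩
  · rintro ⟨ha, hc, hb⟩
    have h1 : Even a := by rw [Int.even_iff]; omega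
    have h2 : Even c := by rw [Int.even_iff]; omega
    rw [weilSum_factor, hq, prod_odd m b hb, if_pos ⟨h1, h2⟩, if_pos ⟨ha, hc⟩]
    ring
  · rintro ⟨ha, hc, hb, hn⟩
    rw [weilSum_factor, hq, prod_odd m b hb, if_pos ⟨ha, hc⟩, if_neg hn]
    ring
  · intro h
    rw [weilSum_factor, hq]
    by_cases hb : ∀ j, Odd (b j)
    · rw [if_neg (fun h' => h ⟨h'.1, h'.2, hb⟩), zero_mul]
    · rw [prod_not_odd m b hb, mul_zero]
end

section
/- For every τ ∈ ℍ one has ϑ_A(τ)² = 1 + 4·∑_{n=1}^∞ d_A(n)·qⁿ/(1−qⁿ), the series converging absolutely, where for each n ≥ 1 the coefficient is the integer d_A(n) = ∑_{(α,β,γ)∈ℤ³, αa+βb+γc=n} χ(gcd(α,β,γ))·r(αγ−β²); here χ : ℤ → ℤ is the nontrivial Dirichlet character modulo 4 (χ(k) = 1 if k ≡ 1 (mod 4), χ(k) = −1 if k ≡ 3 (mod 4), χ(k) = 0 if k is even) and r(k) = #{x ∈ ℤ : x² = k} (so r(k) are the q-expansion coefficients of θ(τ) = ∑_{n∈ℤ}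 q^{n²}); each sum d_A(n) has only finitely many nonzero terms. -/
open scoped BigOperators

/-- The nontrivial Dirichlet character modulo 4 (as a function `ℤ → ℤ`). -/
def chi4 (k : ℤ) : ℤ := if k % 4 = 1 then 1 else if k % 4 = 3 then -1 else 0

/-- `r(k) = #{x ∈ ℤ : x² = k}`, the `q`-expansion coefficients of
`θ(τ) = ∑_{n ∈ ℤ} q^{n²}`. -/
noncomputable def rTheta (k : ℤ) : ℤ := (Set.ncard {x : ℤ | x ^ 2 = k} : ℤ)

/-- The Lambert series coefficient
`d_A(n) = ∑_{αa+βb+γc=n} χ(gcd(α,β,γ))·r(αγ−β²)`. -/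
noncomputable def dLambert (a b c : ℤ) (n : ℤ) : ℤ :=
  ∑ᶠ p : ℤ × ℤ × ℤ,
    if p.1 * a + p.2.1 * b + p.2.2 * c = n then
      chi4 (Int.gcd p.1 (Int.gcd p.2.1 p.2.2) : ℤ) * rTheta (p.1 * p.2.2 - p.2.1 ^ 2)
    else 0


lemma chi4_mul (x y : ℤ) : chi4 (x * y) = chi4 x * chi4 y := by
  unfold chi4
  have hx : x % 4 = 0 ∨ x % 4 = 1 ∨ x % 4 = 2 ∨ x % 4 = 3 := by omega
  have hy : y % 4 = 0 ∨ y % 4 = 1 ∨ y % 4 = 2 ∨ y % 4 = 3 := by omega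
  rcases hx with h | h | h | h <;> rcases hy with hb | hb | hb | hb <;>
    simp [Int.mul_emod, hb, h]

/-- divisor sum of the character -/
def gsum (n : ℕ) : ℤ := ∑ d ∈ n.divisors, chi4 d

lemma gsum_rec (p n : ℕ) (hp : p.Prime) (hn : n ≠ 0) :
    gsum (p * n) = (1 + chi4 p) * gsum n - if p ∣ n then chi4 p * gsum (n / p) else 0 := by
  classical
  have hp0 := hp.pos
  have hU : (p * n).divisors = n.divisors ∪ n.divisors.image (p * ·) := by
    ext d
    simp only [Nat.mem_divisors, Finset.mem_union, Finset.mem_image]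
    constructor
    · rintro ⟨h, h0⟩
      by_cases hd : p ∣ d
      · obtain ⟨e, rfl⟩ := hd
        exact Or.inr ⟨e, ⟨Nat.dvd_of_mul_dvd_mul_left hp0 h, hn⟩, rfl⟩
      · exact Or.inl ⟨(Nat.Coprime.dvd_of_dvd_mul_left
          ((Nat.Prime.coprime_iff_not_dvd hp).2 hd).symm h), hn⟩
    · rintro (⟨h, h0⟩ | ⟨e, ⟨h, h0⟩, rfl⟩)
      · exact ⟨h.mul_left p, by positivity⟩
      · exact ⟨Nat.mul_dvd_mul_left p h, by positivity⟩
  have hinj : Function.Injective (fun x : ℕ => p * x) := fun x y h => by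
    simpa [hp0.ne'] using h
  have hS : ∀ m : ℕ, ∑ d ∈ m.divisors.image (p * ·), chi4 (d : ℤ) = chi4 p * gsum m := by
    intro m
    rw [Finset.sum_image (fun x _ y _ h => hinj h), gsum, Finset.mul_sum]
    exact Finset.sum_congr rfl fun x _ => by push_cast; rw [chi4_mul]
  have hI : ∑ d ∈ n.divisors ∩ n.divisors.image (p * ·), chi4 (d : ℤ)
      = if p ∣ n then chi4 p * gsum (n / p) else 0 := by
    split_ifs with h
    · obtain ⟨m, rfl⟩ := h
      rw [Nat.mul_div_cancel_left _ hp0, ← hS]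
      congr 1
      ext d
      simp only [Nat.mem_divisors, Finset.mem_inter, Finset.mem_image]
      constructor
      · rintro ⟨⟨h, _⟩, e, _, rfl⟩
        exact ⟨e, ⟨Nat.dvd_of_mul_dvd_mul_left hp0 h, by rintro rfl; simp at hn⟩, rfl⟩
      · rintro ⟨e, ⟨h, _⟩, rfl⟩
        exact ⟨⟨Nat.mul_dvd_mul_left p h, hn⟩, e, ⟨h.mul_left p, hn⟩, rfl⟩
    · apply Finset.sum_eq_zero
      intro d hd
      simp only [Nat.mem_divisors, Finset.mem_inter, Finset.mem_image] at hd
      obtain ⟨⟨h1, _⟩, e, _, rfl⟩ := hd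
      exact absurd ((dvd_mul_right p e).trans h1) h
  have := Finset.sum_union_inter (s₁ := n.divisors) (s₂ := n.divisors.image (p * ·))
    (f := fun d : ℕ => chi4 (d : ℤ))
  rw [← hU, hI, hS] at this
  change gsum (p * n) + _ = gsum n + _ at this
  linarith

/-- Gaussian integers of norm `n`. -/
def normSet (n : ℤ) : Set GaussianInt := {z | z.norm = n}

lemma gnorm (z : GaussianInt) : z.norm = z.re ^ 2 + z.im ^ 2 := by
  rw [Zsqrtd.norm_def]; ring

lemma normSet_finite (n : ℤ) : (normSet n).Finite := by
  have : (normSet n) ⊆ (fun p : ℤ × ℤ => (⟨p.1, p.2⟩ : GaussianInt)) ''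
      ((Finset.Icc (-n) n ×ˢ Finset.Icc (-n) n : Finset (ℤ × ℤ)) : Set (ℤ × ℤ)) := by
    intro z hz
    simp only [normSet, Set.mem_ofPred_eq, gnorm] at hz
    refine ⟨(z.re, z.im), ?_, rfl⟩
    simp only [Finset.coe_product, Set.mem_prod, Finset.coe_Icc, Set.mem_Icc]
    refine ⟨⟨?_, ?_⟩, ?_, ?_⟩ <;> nlinarith [Int.le_self_sq z.re, Int.le_self_sq z.im, Int.le_self_sq (-z.re), Int.le_self_sq (-z.im), sq_nonneg z.re, sq_nonneg z.im]
  exact (Set.Finite.image _ (Finset.finite_toSet _)).subset this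

lemma ncard_mul_image (π : GaussianInt) (hπ : π ≠ 0) (n : ℤ) :
    ((fun z => π * z) '' normSet n).ncard = (normSet n).ncard :=
  Set.ncard_image_of_injective _ (mul_right_injective₀ hπ)

lemma mul_image_eq (π : GaussianInt) (hπ : π ≠ 0) (n : ℤ) :
    (fun z => π * z) '' normSet n = {z | z ∈ normSet (π.norm * n) ∧ π ∣ z} := by
  ext z
  simp only [Set.mem_image, normSet, Set.mem_ofPred_eq]
  constructor
  · rintro ⟨w, hw, rfl⟩
    exact ⟨by rw [Zsqrtd.norm_mul, hw], dvd_mul_right _ _⟩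
  · rintro ⟨h, w, rfl⟩
    refine ⟨w, ?_, rfl⟩
    rw [Zsqrtd.norm_mul] at h
    exact mul_left_cancel₀ (by rwa [Ne, GaussianInt.norm_eq_zero]) h

lemma dvd_norm_or {π z : GaussianInt} (hπ : Prime π) {n : ℤ} (h : z.norm = π.norm * n) :
    π ∣ z ∨ star π ∣ z := by
  have : π ∣ z * star z := by
    rw [← Zsqrtd.norm_eq_mul_conj, h]
    push_cast
    rw [Zsqrtd.norm_eq_mul_conj]
    exact ⟨star π * n, by ring⟩
  rcases hπ.dvd_or_dvd this with h | ⟨w, hw⟩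
  · exact Or.inl h
  · right
    refine ⟨star w, ?_⟩
    have := congrArg star hw
    simpa [mul_comm] using this

lemma prime_of_norm {π : GaussianInt} {p : ℕ} (hp : p.Prime) (h : π.norm = p) : Prime π := by
  rw [← irreducible_iff_prime]
  refine ⟨fun hu => ?_, fun x y hxy => ?_⟩
  · rw [← Zsqrtd.norm_eq_one_iff, h] at hu
    exact hp.one_lt.ne' (by simpa using hu)
  · rw [hxy, Zsqrtd.norm_mul] at h
    have h' : x.norm.natAbs * y.norm.natAbs = p := by
      rw [← Int.natAbs_mul, h]; simp
    rw [← Zsqrtd.norm_eq_one_iff, ← Zsqrtd.norm_eq_one_iff]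
    rw [← h'] at hp
    rcases Nat.prime_mul_iff.1 hp with h | h
    · exact Or.inr h.2
    · exact Or.inl h.2

lemma normSet_rec_two (n : ℤ) : (normSet (2 * n)).ncard = (normSet n).ncard := by
  have hπn : (⟨1, 1⟩ : GaussianInt).norm = (2 : ℕ) := by simp [gnorm]
  have hπ := prime_of_norm Nat.prime_two hπn
  rw [← ncard_mul_image _ hπ.ne_zero n, mul_image_eq _ hπ.ne_zero, hπn]
  congr 1
  ext z
  simp only [Nat.cast_ofNat, Set.mem_ofPred_eq, iff_self_and]
  intro hz
  rcases dvd_norm_or hπ (n := n) (z := z) (by rw [hπn]; exact hz) with h | h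
  · exact h
  · refine dvd_trans ⟨⟨0, -1⟩, ?_⟩ h
    ext <;> simp

lemma normSet_rec_three (p : ℕ) (hp : p.Prime) (h3 : p % 4 = 3) (n : ℤ) :
    (normSet (p * n)).ncard = if (p : ℤ) ∣ n then (normSet (n / p)).ncard else 0 := by
  have := Fact.mk hp
  have hπ := GaussianInt.prime_of_nat_prime_of_mod_four_eq_three p h3
  have key : ∀ z ∈ normSet (p * n), (p : GaussianInt) ∣ z := by
    intro z hz
    have : (p : GaussianInt) ∣ z * star z := by
      rw [← Zsqrtd.norm_eq_mul_conj, hz]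
      push_cast
      exact dvd_mul_right _ _
    rcases hπ.dvd_or_dvd this with h | ⟨w, hw⟩
    · exact h
    · refine ⟨star w, ?_⟩
      have := congrArg star hw
      simpa [mul_comm] using this
  have hp0 : (p : ℤ) ≠ 0 := by exact_mod_cast hp.ne_zero
  split_ifs with h
  · obtain ⟨m, rfl⟩ := h
    rw [Int.mul_ediv_cancel_left _ hp0]
    rw [← ncard_mul_image _ hπ.ne_zero m, mul_image_eq _ hπ.ne_zero, Zsqrtd.norm_natCast]
    congr 1
    ext z
    simp only [Set.mem_ofPred_eq, mul_assoc]
    exact ⟨fun h => ⟨h, key z h⟩, fun h => h.1⟩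
  · have : normSet (p * n) = ∅ := by
      ext z
      simp only [Set.mem_empty_iff_false, iff_false]
      intro hz
      obtain ⟨w, rfl⟩ := key z hz
      simp only [normSet, Set.mem_ofPred_eq, Zsqrtd.norm_mul, Zsqrtd.norm_natCast, mul_assoc] at hz
      exact h ⟨_, (mul_left_cancel₀ hp0 hz).symm⟩
    simp [this]

lemma normSet_rec_one (p : ℕ) (hp : p.Prime) (h1 : p % 4 = 1) (n : ℤ) :
    (normSet (p * n)).ncard + (if (p : ℤ) ∣ n then (normSet (n / p)).ncard else 0)
      = 2 * (normSet n).ncard := by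
  have := Fact.mk hp
  obtain ⟨x, y, hxy⟩ := Nat.Prime.sq_add_sq (p := p) (by omega)
  have hp0 : (p : ℤ) ≠ 0 := by exact_mod_cast hp.ne_zero
  set π : GaussianInt := ⟨x, y⟩ with hπd
  have hπn : π.norm = p := by rw [gnorm]; simp only [hπd]; exact_mod_cast hxy
  have hπn' : (star π).norm = p := by rw [Zsqrtd.norm_conj, hπn]
  have hπ := prime_of_norm hp hπn
  have hπ' := prime_of_norm hp hπn'
  have hmul : π * star π = (p : GaussianInt) := by
    rw [← Zsqrtd.norm_eq_mul_conj, hπn]; simp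
  have hnd : ¬ π ∣ star π := by
    intro h
    have h2 : π ∣ ((2 * x : ℤ) : GaussianInt) := by
      have : ((2 * x : ℤ) : GaussianInt) = π + star π := by
        ext <;> simp [hπd]; ring
      rw [this]; exact dvd_add dvd_rfl h
    obtain ⟨w, hw⟩ := h2
    have h3 := congrArg Zsqrtd.norm hw
    rw [Zsqrtd.norm_mul, hπn, Zsqrtd.norm_intCast] at h3
    have h4 : (p : ℤ) ∣ 4 * (x * x) := ⟨w.norm, by rw [← h3]; ring⟩
    have h4' : p ∣ 4 * (x * x) := by exact_mod_cast h4
    rcases (Nat.Prime.dvd_mul hp).1 h4' with h5 | h5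
    · have := (Nat.Prime.dvd_mul hp (m := 2) (n := 2)).1 h5
      have : p ∣ 2 := by tauto
      have := Nat.le_of_dvd (by norm_num) this
      have := hp.two_le
      have : p = 2 := by omega
      omega
    · have hx : p ∣ x := by have := (Nat.Prime.dvd_mul hp).1 h5; tauto
      have hy : p ∣ y ^ 2 := by
        have : p ∣ x ^ 2 + y ^ 2 := by rw [hxy]
        exact (Nat.dvd_add_right (hx.trans (dvd_pow_self x two_ne_zero))).1 this
      have hy := hp.dvd_of_dvd_pow hy
      obtain ⟨u, rfl⟩ := hx
      obtain ⟨v, rfl⟩ := hy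
      have : p * (p * (u ^ 2 + v ^ 2)) = p * 1 := by rw [mul_one]; linarith
      have := Nat.eq_of_mul_eq_mul_left hp.pos this
      exact hp.one_lt.ne' (Nat.eq_one_of_mul_eq_one_right this)
  have hA := mul_image_eq π hπ.ne_zero n
  have hB := mul_image_eq (star π) hπ'.ne_zero n
  have cA := ncard_mul_image π hπ.ne_zero n
  have cB := ncard_mul_image (star π) hπ'.ne_zero n
  rw [hA, hπn] at cA
  rw [hB, hπn'] at cB
  set A := {z | z ∈ normSet (p * n) ∧ π ∣ z}
  set B := {z | z ∈ normSet (p * n) ∧ star π ∣ z}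
  have fA : A.Finite := (normSet_finite (p * n)).subset fun z hz => hz.1
  have fB : B.Finite := (normSet_finite (p * n)).subset fun z hz => hz.1
  have hU : normSet (p * n) = A ∪ B := by
    ext z
    constructor
    · intro hz
      rcases dvd_norm_or hπ (n := n) (z := z) (by rw [hπn]; exact hz) with h | h
      · exact Or.inl ⟨hz, h⟩
      · exact Or.inr ⟨hz, h⟩
    · rintro (h | h)
      · exact h.1
      · exact h.1
  have hI : A ∩ B = {z | z ∈ normSet (p * n) ∧ (p : GaussianInt) ∣ z} := by
    ext z
    constructor
    · rintro ⟨⟨hz, h1⟩, ⟨_, w, rfl⟩⟩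
      refine ⟨hz, ?_⟩
      obtain ⟨v, rfl⟩ := (hπ.dvd_or_dvd h1).resolve_left hnd
      exact ⟨v, by rw [← hmul]; ring⟩
    · rintro ⟨hz, h⟩
      rw [← hmul] at h
      exact ⟨⟨hz, (dvd_mul_right _ _).trans h⟩, ⟨hz, (dvd_mul_left _ _).trans h⟩⟩
  have hpg : (p : GaussianInt) ≠ 0 := by rw [← hmul]; exact mul_ne_zero hπ.ne_zero hπ'.ne_zero
  have cI : (A ∩ B).ncard = if (p : ℤ) ∣ n then (normSet (n / p)).ncard else 0 := by
    rw [hI]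
    split_ifs with h
    · obtain ⟨m, rfl⟩ := h
      rw [Int.mul_ediv_cancel_left _ hp0, ← ncard_mul_image _ hpg m, mul_image_eq _ hpg,
        Zsqrtd.norm_natCast, mul_assoc]
    · rw [Set.ncard_eq_zero ((normSet_finite (p * n)).subset fun z hz => hz.1)]
      ext z
      simp only [Set.mem_empty_iff_false, iff_false]
      rintro ⟨hz, w, rfl⟩
      simp only [normSet, Set.mem_ofPred_eq, Zsqrtd.norm_mul, Zsqrtd.norm_natCast, mul_assoc] at hz
      exact h ⟨_, (mul_left_cancel₀ hp0 hz).symm⟩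
  rw [hU, ← cI, Set.ncard_union_add_ncard_inter A B fA fB, cA, cB]
  ring

lemma normSet_one : (normSet 1).ncard = 4 := by
  have : normSet 1 = ((({⟨1,0⟩, ⟨-1,0⟩, ⟨0,1⟩, ⟨0,-1⟩} : Finset GaussianInt)) : Set GaussianInt) := by
    ext ⟨x, y⟩
    simp only [normSet, Set.mem_ofPred_eq, gnorm, Finset.coe_insert, Finset.coe_singleton,
      Set.mem_insert_iff, Set.mem_singleton_iff, Zsqrtd.ext_iff]
    constructor
    · intro h
      have h1 : -1 ≤ x := by nlinarith
      have h2 : x ≤ 1 := by nlinarith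
      have h3 : -1 ≤ y := by nlinarith
      have h4 : y ≤ 1 := by nlinarith
      interval_cases x <;> interval_cases y <;> simp_all
    · rintro (⟨rfl, rfl⟩ | ⟨rfl, rfl⟩ | ⟨rfl, rfl⟩ | ⟨rfl, rfl⟩) <;> norm_num
  rw [this, Set.ncard_coe_finset]
  decide

/-- The two-square theorem. -/
theorem two_squares (n : ℕ) (hn : n ≠ 0) : ((normSet n).ncard : ℤ) = 4 * gsum n := by
  induction n using Nat.strong_induction_on with
  | _ n ih =>
  by_cases h1 : n = 1
  · subst h1
    simp [normSet_one, gsum, chi4]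
  · have hp := Nat.minFac_prime h1
    obtain ⟨m, hm⟩ := Nat.minFac_dvd n
    set p := n.minFac
    have hm0 : m ≠ 0 := by rintro rfl; simp at hm; exact hn hm
    have hmn : m < n := by
      rw [hm]; have := hp.two_le; nlinarith [Nat.pos_of_ne_zero hm0]
    have i1 := ih m hmn hm0
    have hdiv : ((if (p : ℤ) ∣ (m : ℤ) then (normSet ((m : ℤ) / p)).ncard else 0 : ℕ) : ℤ)
        = 4 * if p ∣ m then gsum (m / p) else 0 := by
      by_cases h : p ∣ m
      · rw [if_pos h, if_pos (by exact_mod_cast h), ← ih (m / p)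
          ((Nat.div_le_self _ _).trans_lt hmn) (by
            have := Nat.div_pos (Nat.le_of_dvd (Nat.pos_of_ne_zero hm0) h) hp.pos; omega)]
        norm_cast
      · rw [if_neg h, if_neg (by exact_mod_cast h)]; simp
    rw [hm, gsum_rec p m hp hm0]
    push_cast
    have e1 : (p % 4 = 1 → chi4 p = 1) := fun h => by
      have : (p : ℤ) % 4 = 1 := by omega
      simp [chi4, this]
    have e3 : (p % 4 = 3 → chi4 p = -1) := fun h => by
      have : (p : ℤ) % 4 = 3 := by omega
      simp [chi4, this]
    rcases hp.eq_two_or_odd with h2 | h2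
    · rw [h2]
      have := normSet_rec_two m
      simp [chi4, this, i1]
    · have h4 : p % 4 = 1 ∨ p % 4 = 3 := by omega
      rcases h4 with h4 | h4
      · have := normSet_rec_one p hp h4 m
        have h := congrArg (Nat.cast (R := ℤ)) this
        push_cast [i1] at h
        push_cast at hdiv
        rw [hdiv] at h
        rw [e1 h4]
        split_ifs at h ⊢ <;> linarith
      · have := normSet_rec_three p hp h4 m
        have h := congrArg (Nat.cast (R := ℤ)) this
        rw [hdiv] at h
        rw [e3 h4, h]
        split_ifs <;> ring

lemma bezout3 (α β γ : ℤ) (hg : Int.gcd α (Int.gcd β γ) = 1) :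
    ∃ x y z : ℤ, x * α + y * β + z * γ = 1 := by
  have h1 := Int.gcd_eq_gcd_ab α (Int.gcd β γ)
  have h2 := Int.gcd_eq_gcd_ab β γ
  rw [hg] at h1
  generalize Int.gcdA α (Int.gcd β γ) = u at *
  generalize Int.gcdB α (Int.gcd β γ) = v at *
  rw [h2] at h1
  exact ⟨u, v * Int.gcdA β γ, v * Int.gcdB β γ, by push_cast at h1; linarith⟩

lemma bezout3' (α β γ δ : ℤ) (h : α * γ = β ^ 2 + δ ^ 2)
    (hg : Int.gcd α (Int.gcd β γ) = 1) :
    ∃ x y z : ℤ, x * α + y * (2 * β) + z * γ = 1 := by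
  obtain ⟨x, y, z, hxyz⟩ := bezout3 α β γ hg
  rcases Int.even_or_odd' α with ⟨k, hk | hk⟩
  · rcases Int.even_or_odd' γ with ⟨l, hl | hl⟩
    · exfalso
      have hβ : Even β := by
        by_contra hb
        rw [Int.not_even_iff_odd] at hb
        obtain ⟨m, rfl⟩ := hb
        rw [hk, hl] at h
        have h4 : δ ^ 2 % 4 = 3 := by
          have : δ ^ 2 = 4 * (k * l - m ^ 2 - m) - 1 := by linarith
          omega
        rcases Int.even_or_odd' δ with ⟨j, rfl | rfl⟩
        · have : (2 * j) ^ 2 = 4 * j ^ 2 := by ring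
          omega
        · have : (2 * j + 1) ^ 2 = 4 * (j ^ 2 + j) + 1 := by ring
          omega
      obtain ⟨m, rfl⟩ := hβ
      rw [hk, hl] at hxyz
      have : 2 * (x * k + y * m + z * l) = 1 := by linarith
      omega
    · exact ⟨-2 * l * x, -l * y, 1 - 2 * l * z, by
        have : γ - l * (2 * 1) = 1 := by linarith
        rw [← hxyz] at this
        linarith⟩
  · exact ⟨1 - 2 * k * x, -k * y, -2 * k * z, by
        have : α - k * (2 * 1) = 1 := by linarith
        rw [← hxyz] at this
        linarith⟩

lemma coprime_of (α β γ : ℤ) (hg : Int.gcd α (Int.gcd β γ) = 1) (v w : GaussianInt)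
    (hv : v.norm = α) (hw : w.norm = γ) (hvw : (star v * w).re = β) : IsCoprime v w := by
  rw [← EuclideanDomain.gcd_isUnit_iff]
  set d := EuclideanDomain.gcd v w
  obtain ⟨v', hv'⟩ := EuclideanDomain.gcd_dvd_left v w
  obtain ⟨w', hw'⟩ := EuclideanDomain.gcd_dvd_right v w
  change v = d * v' at hv'
  change w = d * w' at hw'
  have h1 : d.norm ∣ α := ⟨v'.norm, by rw [← hv, hv', Zsqrtd.norm_mul]⟩
  have h2 : d.norm ∣ γ := ⟨w'.norm, by rw [← hw, hw', Zsqrtd.norm_mul]⟩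
  have h3 : d.norm ∣ β := by
    refine ⟨(star v' * w').re, ?_⟩
    rw [← hvw]
    have : star v * w = (d.norm : GaussianInt) * (star v' * w') := by
      rw [Zsqrtd.norm_eq_mul_conj]
      rw [hv', hw', star_mul]; ring
    rw [this, Zsqrtd.re_mul]
    simp
  obtain ⟨x, y, z, h⟩ := bezout3 α β γ hg
  have : d.norm ∣ 1 := by
    have h4 : d.norm ∣ x * α + y * β + z * γ :=
      dvd_add (dvd_add (h1.mul_left _) (h3.mul_left _)) (h2.mul_left _)
    rwa [h] at h4
  rw [Zsqrtd.isUnit_iff_norm_isUnit]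
  exact isUnit_of_dvd_one this

lemma exists_v (α β γ δ : ℤ) (hα : 0 ≤ α) (hγ : 0 ≤ γ) (h : α * γ = β ^ 2 + δ ^ 2)
    (hg : Int.gcd α (Int.gcd β γ) = 1) :
    ∃ v w : GaussianInt, v.norm = α ∧ w.norm = γ ∧ star v * w = ⟨β, δ⟩ := by
  rcases hα.eq_or_lt with h0 | hα
  · subst h0
    have hb : β = 0 := by nlinarith [sq_nonneg β, sq_nonneg δ]
    have hd : δ = 0 := by nlinarith [sq_nonneg β, sq_nonneg δ]
    subst hb hd
    have : γ = 1 := by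
      simp only [Int.gcd_zero_left, Int.natAbs_natCast] at hg
      omega
    subst this
    exact ⟨0, 1, by simp, by simp, by ext <;> simp⟩
  · set ξ : GaussianInt := ⟨β, δ⟩ with hξ
    have hξξ : ξ * star ξ = (α : GaussianInt) * γ := by
      rw [← Zsqrtd.norm_eq_mul_conj, gnorm]
      simp only [hξ]
      rw [← h]; push_cast; rfl
    set d := EuclideanDomain.gcd (α : GaussianInt) ξ
    obtain ⟨s, hs⟩ := EuclideanDomain.gcd_dvd_left (α : GaussianInt) ξ
    obtain ⟨t, ht⟩ := EuclideanDomain.gcd_dvd_right (α : GaussianInt) ξ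
    change (α : GaussianInt) = d * s at hs
    change ξ = d * t at ht
    have hs' : (α : GaussianInt) = star d * star s := by
      have := congrArg star hs
      rw [star_mul] at this
      rw [mul_comm]
      simpa using this
    have ht' : star ξ = star d * star t := by rw [ht, star_mul, mul_comm]
    obtain ⟨x, y, hxy⟩ : ∃ x y : GaussianInt, d = α * x + ξ * y :=
      ⟨_, _, EuclideanDomain.gcd_eq_gcd_ab _ _⟩
    have hα0 : (α : GaussianInt) ≠ 0 := by exact_mod_cast hα.ne'
    have h1 : (α : GaussianInt) ∣ (d.norm : GaussianInt) := by
      rw [Zsqrtd.norm_eq_mul_conj, hxy]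
      refine ⟨α * x * star x + x * star ξ * star y + ξ * y * star x + γ * (y * star y), ?_⟩
      simp only [star_add, star_mul, star_intCast]
      linear_combination (y * star y) * hξξ
    have h2 : (d.norm : GaussianInt) ∣ (α : GaussianInt) := by
      obtain ⟨X, Y, Z, hb⟩ := bezout3' α β γ δ h hg
      have hb' : (X : GaussianInt) * α + Y * (ξ + star ξ) + Z * γ = 1 := by
        have : ξ + star ξ = ((2 * β : ℤ) : GaussianInt) := by
          ext <;> simp [hξ]; ring
        have hb2 := congrArg (Int.cast (R := GaussianInt)) hb
        rw [this]; push_cast at hb2 ⊢; exact hb2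
      rw [Zsqrtd.norm_eq_mul_conj]
      have e : (α : GaussianInt) = X * (α * α) + Y * (α * ξ + α * star ξ) + Z * (ξ * star ξ) := by
        linear_combination (-(α : GaussianInt)) * hb' - Z * hξξ
      rw [e]
      refine dvd_add (dvd_add (Dvd.dvd.mul_left ?_ _)
        (Dvd.dvd.mul_left (dvd_add ?_ ?_) _)) (Dvd.dvd.mul_left ?_ _)
      · exact ⟨s * star s, by linear_combination (d * s) * hs' + α * hs⟩
      · exact ⟨t * star s, by linear_combination ξ * hs' + star d * star s * ht⟩
      · exact ⟨s * star t, by linear_combination star ξ * hs + d * s * ht'⟩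
      · exact ⟨t * star t, by rw [ht', ht]; ring⟩
    have hn : d.norm = α := by
      rw [Zsqrtd.intCast_dvd_intCast] at h1 h2
      exact Int.dvd_antisymm (GaussianInt.norm_nonneg d) hα.le h2 h1
    refine ⟨star d, t, by rw [Zsqrtd.norm_conj, hn], ?_, by rw [star_star, ht]⟩
    have := congrArg Zsqrtd.norm ht
    rw [Zsqrtd.norm_mul, hn, gnorm] at this
    simp only [hξ] at this
    rw [← h] at this
    exact (mul_left_cancel₀ hα.ne' this).symm

/-- pairs with given Gram data -/
def gram (α β γ δ : ℤ) : Set (GaussianInt × GaussianInt) :=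
  {p | p.1.norm = α ∧ p.2.norm = γ ∧ star p.1 * p.2 = ⟨β, δ⟩}

lemma gram_card (α β γ δ : ℤ) (hα : 0 ≤ α) (hγ : 0 ≤ γ) (h : α * γ - β ^ 2 = δ ^ 2)
    (h0 : 0 < α + γ) :
    (gram α β γ δ).ncard = (normSet (Int.gcd α (Int.gcd β γ))).ncard := by
  obtain ⟨g, hg⟩ : ∃ g : ℕ, g = Int.gcd α (Int.gcd β γ) := ⟨_, rfl⟩
  have hgα : (g : ℤ) ∣ α := hg ▸ Int.gcd_dvd_left _ _
  have hgg : (g : ℤ) ∣ Int.gcd β γ := hg ▸ Int.gcd_dvd_right _ _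
  have hgβ : (g : ℤ) ∣ β := hgg.trans (Int.gcd_dvd_left _ _)
  have hgγ : (g : ℤ) ∣ γ := hgg.trans (Int.gcd_dvd_right _ _)
  have hgδ : (g : ℤ) ∣ δ := by
    rw [← Int.pow_dvd_pow_iff two_ne_zero, ← h]
    refine dvd_sub ?_ (pow_dvd_pow_of_dvd hgβ 2)
    rw [pow_two]; exact mul_dvd_mul hgα hgγ
  rw [← hg]
  obtain ⟨α', rfl⟩ := hgα
  obtain ⟨β', rfl⟩ := hgβ
  obtain ⟨γ', rfl⟩ := hgγ
  obtain ⟨δ', rfl⟩ := hgδ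
  have hg0 : 0 < g := by
    rcases Nat.eq_zero_or_pos g with h | h
    · simp [h] at h0
    · exact h
  have hgz : (0 : ℤ) < g := by exact_mod_cast hg0
  have hg1 : Int.gcd α' (Int.gcd β' γ') = 1 := by
    rw [Int.gcd_mul_left, Int.natAbs_natCast] at hg
    push_cast at hg
    rw [Int.gcd_mul_left, Int.natAbs_natCast] at hg
    exact (Nat.eq_of_mul_eq_mul_left hg0 (by rw [mul_one]; exact hg)).symm
  have hα' : 0 ≤ α' := nonneg_of_mul_nonneg_right hα hgz
  have hγ' : 0 ≤ γ' := nonneg_of_mul_nonneg_right hγ hgz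
  have h' : α' * γ' = β' ^ 2 + δ' ^ 2 := by
    have : (g : ℤ) ^ 2 * (α' * γ') = g ^ 2 * (β' ^ 2 + δ' ^ 2) := by linarith
    exact mul_left_cancel₀ (by positivity) this
  obtain ⟨v, w, hv, hw, hvw⟩ := exists_v α' β' γ' δ' hα' hγ' h' hg1
  obtain ⟨s, t, hst⟩ := coprime_of α' β' γ' hg1 v w hv hw (by rw [hvw])
  have hinj : Function.Injective (fun l : GaussianInt => (l * v, l * w)) := by
    intro l m hlm
    simp only [Prod.mk.injEq] at hlm
    linear_combination (m - l) * hst + s * hlm.1 + t * hlm.2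
  rw [← Set.ncard_image_of_injective _ hinj]
  congr 1
  ext ⟨z, u⟩
  simp only [gram, normSet, Set.mem_ofPred_eq, Set.mem_image, Prod.mk.injEq]
  have hcast : (⟨g * β', g * δ'⟩ : GaussianInt) = (g : GaussianInt) * ⟨β', δ'⟩ := by
    ext <;> simp
  constructor
  · rintro ⟨h1, h2, h3⟩
    rw [hcast, ← hvw] at h3
    have hzz : z * star z = g * (v * star v) := by
      rw [← Zsqrtd.norm_eq_mul_conj, ← Zsqrtd.norm_eq_mul_conj, h1, hv]; push_cast; rfl
    have hc : z * w = u * v := by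
      by_cases hz : z = 0
      · subst hz
        have : v = 0 := by
          rw [← GaussianInt.norm_eq_zero, hv]
          simp at h1
          omega
        simp [this]
      · have hz' : star z ≠ 0 := by simpa using hz
        apply mul_left_cancel₀ hz'
        linear_combination w * hzz - v * h3
    have e1 : (s * z + t * u) * v = z := by linear_combination z * hst - t * hc
    have e2 : (s * z + t * u) * w = u := by linear_combination u * hst + s * hc
    refine ⟨s * z + t * u, ?_, e1, e2⟩
    have n1 := congrArg Zsqrtd.norm e1
    have n2 := congrArg Zsqrtd.norm e2
    rw [Zsqrtd.norm_mul, h1, hv] at n1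
    rw [Zsqrtd.norm_mul, h2, hw] at n2
    have hne : α' + γ' ≠ 0 := by
      intro h
      have : (g : ℤ) * α' + g * γ' = g * (α' + γ') := by ring
      rw [this, h] at h0
      simp at h0
    apply mul_right_cancel₀ hne
    linarith
  · rintro ⟨l, hl, rfl, rfl⟩
    refine ⟨by rw [Zsqrtd.norm_mul, hl, hv], by rw [Zsqrtd.norm_mul, hl, hw], ?_⟩
    rw [hcast, ← hvw, star_mul]
    have : l * star l = g := by
      rw [← Zsqrtd.norm_eq_mul_conj, hl]; simp
    linear_combination star v * w * this

/-- pairs with given real Gram data -/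
def gramR (α β γ : ℤ) : Set (GaussianInt × GaussianInt) :=
  {p | p.1.norm = α ∧ p.2.norm = γ ∧ (star p.1 * p.2).re = β}

lemma gramR_finite (α β γ : ℤ) : (gramR α β γ).Finite :=
  ((normSet_finite α).prod (normSet_finite γ)).subset fun _ h => ⟨h.1, h.2.1⟩

lemma sq_finite (k : ℤ) : {x : ℤ | x ^ 2 = k}.Finite := by
  refine (Set.finite_Icc (-k) k).subset ?_
  intro x (hx : x ^ 2 = k)
  constructor <;> nlinarith [Int.le_self_sq x, Int.le_self_sq (-x)]

lemma gram_id (z w : GaussianInt) :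
    z.norm * w.norm - (star z * w).re ^ 2 = (star z * w).im ^ 2 := by
  simp only [gnorm, Zsqrtd.re_mul, Zsqrtd.im_mul, Zsqrtd.re_star, Zsqrtd.im_star]
  ring

lemma gramR_card (α β γ : ℤ) (hα : 0 ≤ α) (hγ : 0 ≤ γ) (h0 : 0 < α + γ) :
    ((gramR α β γ).ncard : ℤ) =
      4 * (rTheta (α * γ - β ^ 2) * gsum (Int.gcd α (Int.gcd β γ))) := by
  classical
  have hg0 : Int.gcd α (Int.gcd β γ) ≠ 0 := by
    intro h
    rw [Int.gcd_eq_zero_iff] at h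
    have := h.2
    norm_cast at this
    rw [Int.gcd_eq_zero_iff] at this
    omega
  have hf : ∀ x ∈ (gramR_finite α β γ).toFinset,
      (star x.1 * x.2).im ∈ (sq_finite (α * γ - β ^ 2)).toFinset := by
    intro x hx
    simp only [Set.Finite.mem_toFinset, gramR, Set.mem_ofPred_eq] at hx ⊢
    rw [← gram_id, hx.1, hx.2.1, hx.2.2]
  rw [Set.ncard_eq_toFinset_card _ (gramR_finite α β γ), Finset.card_eq_sum_card_fiberwise hf,
    Finset.sum_congr rfl (g := fun _ => (normSet (Int.gcd α (Int.gcd β γ))).ncard),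
    Finset.sum_const]
  · rw [← Set.ncard_eq_toFinset_card _ (sq_finite (α * γ - β ^ 2)), smul_eq_mul]
    push_cast
    rw [two_squares _ hg0, rTheta]
    ring
  · intro δ hδ
    simp only [Set.Finite.mem_toFinset, Set.mem_ofPred_eq] at hδ
    rw [← gram_card α β γ δ hα hγ hδ.symm h0, ← Set.ncard_coe_finset]
    congr 1
    ext x
    simp only [gram, gramR, Finset.coe_filter, Set.Finite.mem_toFinset, Set.mem_ofPred_eq,
      Zsqrtd.ext_iff]
    tauto

/-- linear functional -/
def Lf (a b c : ℤ) (p : ℤ × ℤ × ℤ) : ℤ := p.1 * a + p.2.1 * b + p.2.2 * c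
/-- determinant -/
def Df (p : ℤ × ℤ × ℤ) : ℤ := p.1 * p.2.2 - p.2.1 ^ 2
/-- content -/
def gf (p : ℤ × ℤ × ℤ) : ℕ := Int.gcd p.1 (Int.gcd p.2.1 p.2.2)

lemma psd (α β γ x y : ℤ) (hα : 0 ≤ α) (hγ : 0 ≤ γ) (h : β ^ 2 ≤ α * γ) :
    0 ≤ α * x ^ 2 + 2 * β * x * y + γ * y ^ 2 := by
  rcases hα.eq_or_lt with h0 | h0
  · subst h0
    have : β = 0 := by nlinarith [sq_nonneg β]
    subst this
    have := mul_nonneg hγ (sq_nonneg y)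
    linarith
  · have h1 : 0 ≤ α * (α * x ^ 2 + 2 * β * x * y + γ * y ^ 2) := by
      have := mul_nonneg (sub_nonneg.2 h) (sq_nonneg y)
      nlinarith [sq_nonneg (α * x + β * y)]
    exact nonneg_of_mul_nonneg_right h1 h0


lemma c_pos {a b c : ℤ} (ha : 0 < a) (hD : b ^ 2 - 4 * a * c < 0) : 0 < c := by
  have : 0 < a * c := by nlinarith [sq_nonneg b]
  exact pos_of_mul_pos_right this ha.le

lemma bounds {a b c : ℤ} (ha : 0 < a) (hD : b ^ 2 - 4 * a * c < 0)
    (α β γ : ℤ) (hα : 0 ≤ α) (hγ : 0 ≤ γ) (h : β ^ 2 ≤ α * γ) :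
    γ ≤ 4 * a * (α * a + β * b + γ * c) ∧ α ≤ 4 * c * (α * a + β * b + γ * c) := by
  have h1 := psd α β γ (2 * a) b hα hγ h
  have h2 := psd α β γ b (2 * c) hα hγ h
  have h3 : 0 ≤ (4 * a * c - b ^ 2 - 1) * γ := mul_nonneg (by linarith) hγ
  have h4 : 0 ≤ (4 * a * c - b ^ 2 - 1) * α := mul_nonneg (by linarith) hα
  constructor <;> nlinarith

lemma signs {a b c : ℤ} (ha : 0 < a) (hD : b ^ 2 - 4 * a * c < 0)
    (p : ℤ × ℤ × ℤ) (hL : 0 < Lf a b c p) (hΔ : 0 ≤ Df p) : 0 ≤ p.1 ∧ 0 ≤ p.2.2 := by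
  obtain ⟨α, β, γ⟩ := p
  simp only [Lf, Df] at *
  have hc := c_pos ha hD
  by_contra hcon
  have hle : α ≤ 0 ∧ γ ≤ 0 := by
    have h0 : 0 ≤ α * γ := by nlinarith [sq_nonneg β]
    by_cases h : 0 ≤ α
    · have hγ : γ < 0 := by by_contra h'; exact hcon ⟨h, by linarith⟩
      exact ⟨by nlinarith, hγ.le⟩
    · push Not at h
      exact ⟨h.le, by nlinarith⟩
  have := bounds ha hD (-α) (-β) (-γ) (by linarith) (by linarith) (by nlinarith)
  have h1 : 0 < 4 * a * (α * a + β * b + γ * c) := by positivity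
  have h2 : 0 < 4 * c * (α * a + β * b + γ * c) := by positivity
  nlinarith

lemma box {a b c : ℤ} (ha : 0 < a) (hD : b ^ 2 - 4 * a * c < 0)
    (p : ℤ × ℤ × ℤ) (n : ℤ) (hn : 1 ≤ n) (hL : Lf a b c p = n) (hΔ : 0 ≤ Df p) :
    p ∈ Finset.Icc (-(4 * (a + c) * n)) (4 * (a + c) * n) ×ˢ
      Finset.Icc (-(4 * (a + c) * n)) (4 * (a + c) * n) ×ˢ
      Finset.Icc (-(4 * (a + c) * n)) (4 * (a + c) * n) := by
  obtain ⟨h1, h2⟩ := signs ha hD p (by linarith) hΔ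
  obtain ⟨α, β, γ⟩ := p
  have hc := c_pos ha hD
  simp only [Lf, Df] at *
  obtain ⟨h3, h4⟩ := bounds ha hD α β γ h1 h2 (by linarith)
  rw [hL] at h3 h4
  have e1 : 0 < a * n := by positivity
  have e2 : 0 < c * n := by positivity
  have e3 : 4 * (a + c) * n = 4 * (a * n) + 4 * (c * n) := by ring
  rw [mul_assoc] at h3 h4
  have hβ : |β| ≤ 4 * (a + c) * n := by
    apply abs_le_of_sq_le_sq _ (by linarith)
    have : α * γ ≤ (4 * (a + c) * n) * (4 * (a + c) * n) :=
      mul_le_mul (by linarith) (by linarith) h2 (by linarith)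
    nlinarith
  rw [abs_le] at hβ
  simp only [Finset.mem_product, Finset.mem_Icc]
  refine ⟨⟨?_, ?_⟩, hβ, ?_, ?_⟩ <;> linarith

/-- the relevant triples -/
def Sset (a b c n : ℤ) : Set (ℤ × ℤ × ℤ) := {p | Lf a b c p = n ∧ 0 ≤ Df p}

lemma Sset_finite {a b c : ℤ} (ha : 0 < a) (hD : b ^ 2 - 4 * a * c < 0)
    (n : ℤ) (hn : 1 ≤ n) : (Sset a b c n).Finite :=
  (Finset.finite_toSet _).subset fun p hp => box ha hD p n hn hp.1 hp.2

lemma Sset_card {a b c : ℤ} (ha : 0 < a) (hD : b ^ 2 - 4 * a * c < 0)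
    (n : ℤ) (hn : 1 ≤ n) :
    ((Sset_finite ha hD n hn).toFinset.card : ℤ) ≤ (12 * (a + c) * n) ^ 3 := by
  have hc := c_pos ha hD
  have h1 : (Sset_finite ha hD n hn).toFinset ⊆
      Finset.Icc (-(4 * (a + c) * n)) (4 * (a + c) * n) ×ˢ
      Finset.Icc (-(4 * (a + c) * n)) (4 * (a + c) * n) ×ˢ
      Finset.Icc (-(4 * (a + c) * n)) (4 * (a + c) * n) := by
    intro p hp
    rw [Set.Finite.mem_toFinset] at hp
    exact box ha hD p n hn hp.1 hp.2
  have h2 := Finset.card_le_card h1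
  rw [Finset.card_product, Finset.card_product, Int.card_Icc] at h2
  have h3 : 1 ≤ (a + c) * n := by nlinarith
  have h4 : (((4 * (a + c) * n + 1 - -(4 * (a + c) * n)).toNat : ℕ) : ℤ) ≤ 12 * (a + c) * n := by
    rw [Int.toNat_of_nonneg (by nlinarith)]
    nlinarith
  generalize (4 * (a + c) * n + 1 - -(4 * (a + c) * n)).toNat = m at *
  calc ((Sset_finite ha hD n hn).toFinset.card : ℤ) ≤ ((m * (m * m) : ℕ) : ℤ) := by
        exact_mod_cast h2
    _ = (m : ℤ) ^ 3 := by push_cast; ring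
    _ ≤ _ := pow_le_pow_left₀ (by positivity) h4 3

lemma rTheta_neg (k : ℤ) (h : k < 0) : rTheta k = 0 := by
  have : {x : ℤ | x ^ 2 = k} = ∅ := by
    ext x
    simp only [Set.mem_ofPred_eq, Set.mem_empty_iff_false, iff_false]
    nlinarith [sq_nonneg x]
  simp [rTheta, this]

lemma rTheta_le (k : ℤ) : rTheta k ≤ 2 := by
  unfold rTheta
  rcases Set.eq_empty_or_nonempty {x : ℤ | x ^ 2 = k} with h | ⟨x, hx⟩
  · simp [h]
  · have h1 : {x : ℤ | x ^ 2 = k} ⊆ ((({x, -x} : Finset ℤ)) : Set ℤ) := by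
      intro y hy
      have : y ^ 2 = x ^ 2 := by rw [show y ^ 2 = k from hy, show x ^ 2 = k from hx]
      simpa using sq_eq_sq_iff_eq_or_eq_neg.1 this
    have h2 := Set.ncard_le_ncard h1 (Finset.finite_toSet _)
    rw [Set.ncard_coe_finset] at h2
    exact_mod_cast h2.trans Finset.card_le_two

lemma rTheta_nonneg (k : ℤ) : 0 ≤ rTheta k := by unfold rTheta; positivity

lemma rTheta_sq_mul (j k : ℤ) (hj : j ≠ 0) : rTheta (j ^ 2 * k) = rTheta k := by
  unfold rTheta
  rw [← Set.ncard_image_of_injective {x : ℤ | x ^ 2 = k} (mul_right_injective₀ hj)]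
  congr 2
  ext x
  simp only [Set.mem_ofPred_eq, Set.mem_image]
  constructor
  · intro h
    have : j ∣ x := by
      rw [← Int.pow_dvd_pow_iff two_ne_zero, h]; exact dvd_mul_right _ _
    obtain ⟨y, rfl⟩ := this
    refine ⟨y, ?_, rfl⟩
    rw [mul_pow] at h
    exact mul_left_cancel₀ (pow_ne_zero 2 hj) h
  · rintro ⟨y, hy, rfl⟩
    rw [mul_pow, hy]

lemma chi4_abs (k : ℤ) : |chi4 k| ≤ 1 := by
  unfold chi4; split_ifs <;> simp

/-- summand -/
noncomputable def tf (p : ℤ × ℤ × ℤ) : ℤ := chi4 (gf p) * rTheta (Df p)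

lemma tf_abs (p : ℤ × ℤ × ℤ) : |tf p| ≤ 2 := by
  rw [tf, abs_mul, abs_of_nonneg (rTheta_nonneg _)]
  have := chi4_abs (gf p)
  have := rTheta_le (Df p)
  have := rTheta_nonneg (Df p)
  nlinarith [abs_nonneg (chi4 (gf p))]


lemma support_finite {a b c : ℤ} (ha : 0 < a) (hD : b ^ 2 - 4 * a * c < 0)
    (n : ℤ) (hn : 1 ≤ n) : {p : ℤ × ℤ × ℤ | p.1 * a + p.2.1 * b + p.2.2 * c = n ∧
        chi4 (Int.gcd p.1 (Int.gcd p.2.1 p.2.2) : ℤ) *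
          rTheta (p.1 * p.2.2 - p.2.1 ^ 2) ≠ 0}.Finite := by
  refine (Sset_finite ha hD n hn).subset ?_
  rintro p ⟨h1, h2⟩
  refine ⟨h1, ?_⟩
  by_contra h
  exact h2 (by rw [rTheta_neg (p.1 * p.2.2 - p.2.1 ^ 2) (not_le.1 h), mul_zero])

lemma dLambert_eq {a b c : ℤ} (ha : 0 < a) (hD : b ^ 2 - 4 * a * c < 0)
    (n : ℤ) (hn : 1 ≤ n) :
    dLambert a b c n = ∑ p ∈ (Sset_finite ha hD n hn).toFinset, tf p := by
  unfold dLambert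
  rw [finsum_eq_sum_of_support_subset (s := (Sset_finite ha hD n hn).toFinset)]
  · apply Finset.sum_congr rfl
    intro p hp
    rw [Set.Finite.mem_toFinset] at hp
    rw [if_pos (show p.1 * a + p.2.1 * b + p.2.2 * c = n from hp.1)]
    rfl
  · intro p hp
    simp only [Function.mem_support, ne_eq, ite_eq_right_iff, not_forall] at hp
    obtain ⟨h1, h2⟩ := hp
    rw [Set.Finite.coe_toFinset]
    refine ⟨h1, ?_⟩
    by_contra h
    exact h2 (by rw [rTheta_neg (p.1 * p.2.2 - p.2.1 ^ 2) (not_le.1 h), mul_zero])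

lemma dLambert_bound {a b c : ℤ} (ha : 0 < a) (hD : b ^ 2 - 4 * a * c < 0)
    (n : ℤ) (hn : 1 ≤ n) :
    |dLambert a b c n| ≤ 2 * (12 * (a + c)) ^ 3 * n ^ 3 := by
  rw [dLambert_eq ha hD n hn]
  refine (Finset.abs_sum_le_sum_abs _ _).trans ?_
  refine (Finset.sum_le_card_nsmul _ _ 2 (fun p _ => tf_abs p)).trans ?_
  have := Sset_card ha hD n hn
  rw [nsmul_eq_mul]
  calc _ ≤ (12 * (a + c) * n) ^ 3 * 2 := by linarith
    _ = _ := by ring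

/-- gram triple of a pair -/
def tri (p : GaussianInt × GaussianInt) : ℤ × ℤ × ℤ :=
  (p.1.norm, (star p.1 * p.2).re, p.2.norm)

lemma tri_D {a b c : ℤ} (ha : 0 < a) (hD : b ^ 2 - 4 * a * c < 0)
    (p : GaussianInt × GaussianInt) : 0 ≤ Df (tri p) := by
  simp only [Df, tri]
  rw [gram_id]
  positivity

/-- pairs of value n -/
def Rset (a b c n : ℤ) : Set (GaussianInt × GaussianInt) := {p | Lf a b c (tri p) = n}

lemma gramR_card_pos {a b c : ℤ} (ha : 0 < a) (hD : b ^ 2 - 4 * a * c < 0)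
    (p : ℤ × ℤ × ℤ) (n : ℤ) (hn : 1 ≤ n) (hp : p ∈ Sset a b c n) :
    ((gramR p.1 p.2.1 p.2.2).ncard : ℤ) = 4 * (rTheta (Df p) * gsum (gf p)) := by
  obtain ⟨hL, hd⟩ := hp
  obtain ⟨h1, h2⟩ := signs ha hD p (by linarith) hd
  apply gramR_card _ _ _ h1 h2
  rcases h1.eq_or_lt with h | h
  · rcases h2.eq_or_lt with h' | h'
    · exfalso
      have hb : p.2.1 = 0 := by
        simp only [Df, ← h] at hd
        nlinarith [sq_nonneg p.2.1]
      simp only [Lf, ← h, ← h', hb] at hL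
      omega
    · linarith
  · linarith

lemma Rset_finite {a b c : ℤ} (ha : 0 < a) (hD : b ^ 2 - 4 * a * c < 0)
    (n : ℤ) (hn : 1 ≤ n) : (Rset a b c n).Finite := by
  refine ((Sset_finite ha hD n hn).biUnion (t := fun p => gramR p.1 p.2.1 p.2.2)
    (fun p _ => gramR_finite _ _ _)).subset ?_
  intro x hx
  rw [Set.mem_iUnion₂]
  exact ⟨tri x, ⟨hx, tri_D ha hD x⟩, rfl, rfl, rfl⟩

lemma Rset_card {a b c : ℤ} (ha : 0 < a) (hD : b ^ 2 - 4 * a * c < 0)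
    (n : ℤ) (hn : 1 ≤ n) :
    ((Rset a b c n).ncard : ℤ) =
      4 * ∑ p ∈ (Sset_finite ha hD n hn).toFinset, rTheta (Df p) * gsum (gf p) := by
  classical
  have hf : ∀ x ∈ (Rset_finite ha hD n hn).toFinset,
      tri x ∈ (Sset_finite ha hD n hn).toFinset := by
    intro x hx
    rw [Set.Finite.mem_toFinset] at hx ⊢
    exact ⟨hx, tri_D ha hD x⟩
  rw [Set.ncard_eq_toFinset_card _ (Rset_finite ha hD n hn),
    Finset.card_eq_sum_card_fiberwise hf, Finset.mul_sum]
  push_cast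
  apply Finset.sum_congr rfl
  intro p hp
  rw [Set.Finite.mem_toFinset] at hp
  rw [← gramR_card_pos ha hD p n hn hp, ← Set.ncard_coe_finset]
  congr 2
  ext x
  simp only [Finset.coe_filter, Set.Finite.mem_toFinset, gramR, Set.mem_ofPred_eq]
  constructor
  · rintro ⟨_, rfl⟩
    exact ⟨rfl, rfl, rfl⟩
  · rintro ⟨h1, h2, h3⟩
    have : tri x = p := by ext <;> simp [tri, *]
    refine ⟨?_, this⟩
    change Lf a b c (tri x) = n
    rw [this]; exact hp.1

lemma Rset_card_div {a b c : ℤ} (ha : 0 < a) (hD : b ^ 2 - 4 * a * c < 0)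
    (n : ℕ) (hn : 1 ≤ n) :
    ((Rset a b c n).ncard : ℤ) = 4 * ∑ k ∈ n.divisors, dLambert a b c ((n / k : ℕ) : ℤ) := by
  classical
  have hn' : (1 : ℤ) ≤ n := by exact_mod_cast hn
  rw [Rset_card ha hD n hn']
  congr 1
  set S := (Sset_finite ha hD n hn').toFinset
  have hgd : ∀ p ∈ S, gf p ∣ n := by
    intro p hp
    rw [Set.Finite.mem_toFinset] at hp
    have h1 : (gf p : ℤ) ∣ p.1 := Int.gcd_dvd_left _ _
    have hg : (gf p : ℤ) ∣ Int.gcd p.2.1 p.2.2 := Int.gcd_dvd_right _ _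
    have h2 : (gf p : ℤ) ∣ p.2.1 := hg.trans (Int.gcd_dvd_left _ _)
    have h3 : (gf p : ℤ) ∣ p.2.2 := hg.trans (Int.gcd_dvd_right _ _)
    have : (gf p : ℤ) ∣ (n : ℤ) := by
      rw [← hp.1]
      exact dvd_add (dvd_add (h1.mul_right _) (h2.mul_right _)) (h3.mul_right _)
    exact_mod_cast this
  have step1 : ∀ p ∈ S, rTheta (Df p) * gsum (gf p) =
      ∑ j ∈ n.divisors, if j ∣ gf p then rTheta (Df p) * chi4 ((gf p / j : ℕ) : ℤ) else 0 := by
    intro p hp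
    have hd := hgd p hp
    rw [← Finset.sum_filter]
    have : n.divisors.filter (fun j => j ∣ gf p) = (gf p).divisors := by
      ext j
      simp only [Finset.mem_filter, Nat.mem_divisors]
      constructor
      · rintro ⟨h, h'⟩
        exact ⟨h', fun h0 => by rw [h0, zero_dvd_iff] at hd; omega⟩
      · rintro ⟨h, h'⟩
        exact ⟨⟨h.trans hd, by omega⟩, h⟩
    rw [this, gsum, ← Finset.mul_sum, Nat.sum_div_divisors (gf p) (fun d => chi4 (d : ℤ))]
  rw [Finset.sum_congr rfl step1, Finset.sum_comm]
  apply Finset.sum_congr rfl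
  intro j hj
  have hjn := Nat.dvd_of_mem_divisors hj
  have hj0 : 0 < j := Nat.pos_of_mem_divisors hj
  obtain ⟨m, rfl⟩ := hjn
  rw [Nat.mul_div_cancel_left _ hj0]
  have hm : (1 : ℤ) ≤ m := by
    have : m ≠ 0 := by rintro rfl; omega
    omega
  have hjz : (j : ℤ) ≠ 0 := by exact_mod_cast hj0.ne'
  rw [dLambert_eq ha hD m hm, ← Finset.sum_filter]
  have gmul : ∀ p : ℤ × ℤ × ℤ, gf (j * p.1, j * p.2.1, j * p.2.2) = j * gf p := by
    intro p
    simp only [gf]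
    rw [Int.gcd_mul_left (j : ℤ) p.2.1 p.2.2, Int.natAbs_natCast]
    push_cast
    rw [Int.gcd_mul_left, Int.natAbs_natCast]
  have Dmul : ∀ p : ℤ × ℤ × ℤ, Df (j * p.1, j * p.2.1, j * p.2.2) = (j : ℤ) ^ 2 * Df p := by
    intro p; simp only [Df]; ring
  symm
  apply Finset.sum_bij (fun p _ => ((j * p.1, j * p.2.1, j * p.2.2) : ℤ × ℤ × ℤ))
  · intro p hp
    rw [Set.Finite.mem_toFinset] at hp
    rw [Finset.mem_filter, Set.Finite.mem_toFinset, gmul]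
    refine ⟨⟨?_, ?_⟩, dvd_mul_right _ _⟩
    · rw [Nat.cast_mul, ← hp.1]; simp only [Lf]; ring
    · rw [Dmul]; have := hp.2; positivity
  · intro p _ q _ h
    simp only [Prod.mk.injEq, mul_right_inj' hjz] at h
    ext
    · exact h.1
    · exact h.2.1
    · exact h.2.2
  · rintro ⟨α, β, γ⟩ hp
    rw [Finset.mem_filter, Set.Finite.mem_toFinset] at hp
    obtain ⟨hp, hd⟩ := hp
    have hd : (j : ℤ) ∣ gf (α, β, γ) := by exact_mod_cast hd
    have h1 : (j : ℤ) ∣ α := hd.trans (Int.gcd_dvd_left _ _)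
    have hg : (j : ℤ) ∣ Int.gcd β γ := hd.trans (Int.gcd_dvd_right _ _)
    obtain ⟨β', rfl⟩ := hg.trans (Int.gcd_dvd_left _ _)
    obtain ⟨γ', rfl⟩ := hg.trans (Int.gcd_dvd_right _ _)
    obtain ⟨α', rfl⟩ := h1
    refine ⟨(α', β', γ'), ?_, rfl⟩
    rw [Set.Finite.mem_toFinset]
    constructor
    · have := hp.1
      rw [Nat.cast_mul] at this
      apply mul_left_cancel₀ hjz
      rw [← this]
      simp only [Lf]; ring
    · have := hp.2
      rw [Dmul (α', β', γ')] at this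
      exact nonneg_of_mul_nonneg_right this (by positivity)
  · intro p hp
    rw [gmul, Dmul, rTheta_sq_mul _ _ hjz, Nat.mul_div_cancel_left _ hj0, tf, mul_comm]

lemma Lf_tri_bounds {a b c : ℤ} (ha : 0 < a) (hD : b ^ 2 - 4 * a * c < 0)
    (p : GaussianInt × GaussianInt) :
    p.1.norm + p.2.norm ≤ 4 * (a + c) * Lf a b c (tri p) := by
  have := bounds ha hD p.1.norm (star p.1 * p.2).re p.2.norm (GaussianInt.norm_nonneg _)
    (GaussianInt.norm_nonneg _) (by have := tri_D ha hD p; simp only [Df, tri] at this; linarith)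
  simp only [Lf, tri]
  linarith

lemma Lf_tri_nonneg {a b c : ℤ} (ha : 0 < a) (hD : b ^ 2 - 4 * a * c < 0)
    (p : GaussianInt × GaussianInt) : 0 ≤ Lf a b c (tri p) := by
  have h := Lf_tri_bounds ha hD p
  have h1 := GaussianInt.norm_nonneg p.1
  have h2 := GaussianInt.norm_nonneg p.2
  have hc := c_pos ha hD
  exact nonneg_of_mul_nonneg_right (h1.trans (by linarith) : (0 : ℤ) ≤ 4 * (a + c) * Lf a b c (tri p))
    (by linarith)

lemma Rset_zero {a b c : ℤ} (ha : 0 < a) (hD : b ^ 2 - 4 * a * c < 0) : Rset a b c 0 = {(0, 0)} := by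
  ext p
  simp only [Rset, Set.mem_ofPred_eq, Set.mem_singleton_iff]
  constructor
  · intro h
    have h' := Lf_tri_bounds ha hD p
    have h1 := GaussianInt.norm_nonneg p.1
    have h2 := GaussianInt.norm_nonneg p.2
    rw [h, mul_zero] at h'
    ext1
    · rw [← GaussianInt.norm_eq_zero]; omega
    · rw [← GaussianInt.norm_eq_zero]; omega
  · rintro rfl
    simp [Lf, tri]

lemma summable_natAbs (s : ℝ) (h0 : 0 ≤ s) (h1 : s < 1) : Summable fun m : ℤ => s ^ m.natAbs := by
  rw [summable_int_iff_summable_nat_and_neg]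
  simp [summable_geometric_of_lt_one h0 h1]

lemma summable_A {a b c : ℤ} (ha : 0 < a) (hD : b ^ 2 - 4 * a * c < 0) (Q : ℂ) (hQ0 : Q ≠ 0)
    (hQ : ‖Q‖ < 1) :
    Summable fun p : ℤ × ℤ => ‖Q ^ (a * p.1 ^ 2 + b * p.1 * p.2 + c * p.2 ^ 2)‖ := by
  have hc := c_pos ha hD
  have hr : 0 < ‖Q‖ := norm_pos_iff.2 hQ0
  obtain ⟨K, hK⟩ : ∃ K : ℕ, (K : ℤ) = 4 * (a + c) := ⟨(4 * (a + c)).toNat, by omega⟩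
  have hK0 : K ≠ 0 := by omega
  set s : ℝ := ‖Q‖ ^ ((K : ℝ)⁻¹) with hs
  have hs0 : 0 ≤ s := by positivity
  have hs1 : s < 1 := Real.rpow_lt_one hr.le hQ (by positivity)
  have hsK : s ^ K = ‖Q‖ := Real.rpow_inv_natCast_pow hr.le hK0
  have hsum : Summable fun p : ℤ × ℤ => s ^ p.1.natAbs * s ^ p.2.natAbs :=
    (summable_natAbs s hs0 hs1).mul_of_nonneg (summable_natAbs s hs0 hs1)
      (fun _ => by positivity) (fun _ => by positivity)
  refine Summable.of_nonneg_of_le (fun _ => norm_nonneg _) (fun p => ?_) hsum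
  obtain ⟨m, n⟩ := p
  have hb := bounds ha hD (m ^ 2) (m * n) (n ^ 2) (by positivity) (by positivity)
    (le_of_eq (by ring))
  have hE : m ^ 2 * a + m * n * b + n ^ 2 * c = a * m ^ 2 + b * m * n + c * n ^ 2 := by ring
  rw [hE] at hb
  simp only
  generalize a * m ^ 2 + b * m * n + c * n ^ 2 = E at *
  have hE0 : 0 ≤ E := by
    have : 0 ≤ 4 * a * E := (sq_nonneg n).trans hb.1
    exact nonneg_of_mul_nonneg_right this (by linarith)
  obtain ⟨e, rfl⟩ := Int.eq_ofNat_of_zero_le hE0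
  rw [zpow_natCast, norm_pow, ← hsK, ← pow_mul, ← pow_add]
  apply pow_le_pow_of_le_one hs0 hs1.le
  zify
  rw [hK]
  have h1 : |m| ≤ m ^ 2 := by rw [← sq_abs]; exact Int.le_self_sq _
  have h2 : |n| ≤ n ^ 2 := by rw [← sq_abs]; exact Int.le_self_sq _
  linarith [hb.1, hb.2]

/-- rearrangement of coordinates -/
def coordEquiv : (ℤ × ℤ) × (ℤ × ℤ) ≃ GaussianInt × GaussianInt where
  toFun p := (⟨p.1.1, p.2.1⟩, ⟨p.1.2, p.2.2⟩)
  invFun q := ((q.1.re, q.2.re), (q.1.im, q.2.im))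
  left_inv _ := rfl
  right_inv _ := rfl

lemma coord_L (a b c : ℤ) (p : (ℤ × ℤ) × (ℤ × ℤ)) : Lf a b c (tri (coordEquiv p)) =
    (a * p.1.1 ^ 2 + b * p.1.1 * p.1.2 + c * p.1.2 ^ 2) +
    (a * p.2.1 ^ 2 + b * p.2.1 * p.2.2 + c * p.2.2 ^ 2) := by
  simp only [Lf, tri, coordEquiv, Equiv.coe_fn_mk, gnorm, Zsqrtd.re_mul, Zsqrtd.re_star,
    Zsqrtd.im_star]
  ring

lemma theta_sq {a b c : ℤ} (ha : 0 < a) (hD : b ^ 2 - 4 * a * c < 0) (Q : ℂ) (hQ0 : Q ≠ 0)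
    (hQ : ‖Q‖ < 1) :
    HasSum (fun n : ℕ => ((Rset a b c n).ncard : ℂ) * Q ^ n)
      ((∑' p : ℤ × ℤ, Q ^ (a * p.1 ^ 2 + b * p.1 * p.2 + c * p.2 ^ 2)) ^ 2) := by
  have hs := summable_A ha hD Q hQ0 hQ
  have hprod := summable_mul_of_summable_norm hs hs
  have e : ∀ p : (ℤ × ℤ) × (ℤ × ℤ),
      Q ^ (a * p.1.1 ^ 2 + b * p.1.1 * p.1.2 + c * p.1.2 ^ 2) *
      Q ^ (a * p.2.1 ^ 2 + b * p.2.1 * p.2.2 + c * p.2.2 ^ 2) =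
      (fun q => Q ^ (Lf a b c (tri q))) (coordEquiv p) := by
    intro p
    simp only
    rw [coord_L]
    exact (zpow_add₀ hQ0 _ _).symm
  have h1 : HasSum (fun q => Q ^ (Lf a b c (tri q)))
      ((∑' p : ℤ × ℤ, Q ^ (a * p.1 ^ 2 + b * p.1 * p.2 + c * p.2 ^ 2)) ^ 2) := by
    rw [pow_two, tsum_mul_tsum_of_summable_norm hs hs, ← coordEquiv.hasSum_iff]
    have := hprod.hasSum
    simp only [e] at this ⊢
    exact this
  let f : GaussianInt × GaussianInt → ℕ := fun q => (Lf a b c (tri q)).toNat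
  have h2 := (Equiv.sigmaFiberEquiv f).hasSum_iff.2 h1
  refine h2.sigma (g := fun n : ℕ => ((Rset a b c n).ncard : ℂ) * Q ^ n) fun n => ?_
  have hfin : (Rset a b c n).Finite := by
    rcases Nat.eq_zero_or_pos n with h | h
    · subst h; rw [Nat.cast_zero, Rset_zero ha hD]; exact Set.finite_singleton _
    · exact Rset_finite ha hD n (by exact_mod_cast h)
  have hset : {x | f x = n} = Rset a b c n := by
    ext x
    have := Lf_tri_nonneg ha hD x
    simp only [f, Rset, Set.mem_ofPred_eq]
    omega
  have hval : ∀ y : {x // f x = n},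
      ((fun q => Q ^ (Lf a b c (tri q))) ∘ (Equiv.sigmaFiberEquiv f)) ⟨n, y⟩ = Q ^ n := by
    rintro ⟨y, hy⟩
    have h0 := Lf_tri_nonneg ha hD y
    simp only [Function.comp, Equiv.sigmaFiberEquiv, Equiv.coe_fn_mk]
    have : Lf a b c (tri y) = (n : ℤ) := by simp only [f] at hy; omega
    rw [this, zpow_natCast]
  simp only [hval]
  have : Finite {x // f x = n} := by
    have : Finite ↑{x | f x = n} := by rw [hset]; exact hfin
    exact this
  have := Fintype.ofFinite {x // f x = n}
  convert hasSum_fintype (fun _ : {x // f x = n} => Q ^ n) using 1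
  rw [Finset.sum_const, nsmul_eq_mul, ← hset, Finset.card_univ, ← Nat.card_eq_fintype_card]
  rfl

lemma lambert {a b c : ℤ} (ha : 0 < a) (hD : b ^ 2 - 4 * a * c < 0) (Q : ℂ) (hQ : ‖Q‖ < 1) :
    (Summable fun n : ℕ =>
        ‖(dLambert a b c (n + 1) : ℂ) * Q ^ (n + 1) / (1 - Q ^ (n + 1))‖) ∧
    ∑' n : ℕ, (dLambert a b c (n + 1) : ℂ) * Q ^ (n + 1) / (1 - Q ^ (n + 1)) =
      ∑' n : ℕ, (∑ k ∈ (n + 1).divisors, (dLambert a b c (((n + 1) / k : ℕ) : ℤ) : ℂ))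
        * Q ^ (n + 1) := by
  have hc := c_pos ha hD
  set C : ℝ := 2 * (12 * ((a : ℝ) + c)) ^ 3 with hC
  have hC0 : 0 ≤ C := by
    have : (0 : ℝ) < a := by exact_mod_cast ha
    have : (0 : ℝ) < c := by exact_mod_cast hc
    positivity
  have hbd : ∀ n : ℕ, 1 ≤ n → ‖(dLambert a b c n : ℂ)‖ ≤ C * (n : ℝ) ^ 3 := by
    intro n hn
    have := dLambert_bound ha hD n (by exact_mod_cast hn)
    rw [Complex.norm_intCast, hC]
    exact_mod_cast this
  have hQn : ∀ n : ℕ, 1 ≤ n → ‖Q ^ n‖ < 1 := fun n hn => by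
    rw [norm_pow]; exact pow_lt_one₀ (norm_nonneg _) hQ (by omega)
  constructor
  · have h1 := summable_norm_pow_mul_geometric_div_one_sub (𝕜 := ℂ) 3 hQ
    have h2 := ((summable_nat_add_iff 1).2 h1.norm).mul_left C
    refine Summable.of_nonneg_of_le (fun _ => norm_nonneg _) (fun n => ?_) h2
    have := hbd (n + 1) (by omega)
    rw [norm_div, norm_mul, norm_div, norm_mul, ← mul_div_assoc, ← mul_assoc]
    gcongr
    rw [norm_pow, Complex.norm_natCast]
    exact_mod_cast this
  · have hsum : Summable fun x : ℕ+ × ℕ+ =>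
        (dLambert a b c ((x.2 : ℕ) : ℤ) : ℂ) * Q ^ ((x.1 : ℕ) * (x.2 : ℕ)) := by
      have h1 := ((summable_prod_mul_pow (𝕜 := ℂ) 3 hQ).norm).mul_left C
      refine Summable.of_norm_bounded h1 (fun x => ?_)
      have := hbd x.2 x.2.2
      rw [norm_mul, norm_mul, ← mul_assoc]
      gcongr
      rw [norm_pow, Complex.norm_natCast]
      exact this
    have hL : ∑' x : ℕ+ × ℕ+,
        (dLambert a b c ((x.2 : ℕ) : ℤ) : ℂ) * Q ^ ((x.1 : ℕ) * (x.2 : ℕ)) =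
        ∑' n : ℕ, (dLambert a b c (n + 1) : ℂ) * Q ^ (n + 1) / (1 - Q ^ (n + 1)) := by
      rw [hsum.tsum_prod, Summable.tsum_comm (by exact hsum.prod_symm)]
      rw [tsum_pnat_eq_tsum_succ (f := fun n : ℕ => ∑' m : ℕ+,
        (dLambert a b c (n : ℤ) : ℂ) * Q ^ ((m : ℕ) * n))]
      refine tsum_congr fun n => ?_
      rw [tsum_pnat_eq_tsum_succ (f := fun m : ℕ =>
        (dLambert a b c ((n + 1 : ℕ) : ℤ) : ℂ) * Q ^ (m * (n + 1)))]
      have hg := tsum_geometric_of_norm_lt_one (hQn (n + 1) (by omega))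
      rw [div_eq_mul_inv, ← hg, mul_assoc, ← tsum_mul_left, ← tsum_mul_left]
      push_cast
      refine tsum_congr fun m => ?_
      rw [← pow_mul, ← pow_add]; congr 2; ring
    rw [← hL, ← sigmaAntidiagonalEquivProd.tsum_eq]
    have hs2 := sigmaAntidiagonalEquivProd.summable_iff.2 hsum
    rw [Summable.tsum_sigma (by exact hs2)]
    rw [← tsum_pnat_eq_tsum_succ (f := fun n : ℕ =>
      (∑ k ∈ n.divisors, (dLambert a b c ((n / k : ℕ) : ℤ) : ℂ)) * Q ^ n)]
    refine tsum_congr fun n => ?_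
    rw [tsum_fintype, Finset.sum_mul]
    simp only [sigmaAntidiagonalEquivProd, divisorsAntidiagonalFactors, Equiv.coe_fn_mk,
      PNat.mk_coe, Finset.univ_eq_attach]
    rw [(n : ℕ).divisorsAntidiagonal.sum_attach
      fun x : ℕ × ℕ => (dLambert a b c (x.2 : ℤ) : ℂ) * Q ^ (x.1 * x.2),
      Nat.sum_divisorsAntidiagonal fun x y => (dLambert a b c (y : ℤ) : ℂ) * Q ^ (x * y)]
    refine Finset.sum_congr rfl fun i hi => ?_
    rw [Nat.mul_div_cancel' (Nat.dvd_of_mem_divisors hi)]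

theorem binary_theta_squared_lambert_series (a b c : ℤ) (ha : 0 < a)
    (hD : b ^ 2 - 4 * a * c < 0) :
    (∀ n : ℤ, 1 ≤ n →
      {p : ℤ × ℤ × ℤ | p.1 * a + p.2.1 * b + p.2.2 * c = n ∧
        chi4 (Int.gcd p.1 (Int.gcd p.2.1 p.2.2) : ℤ) *
          rTheta (p.1 * p.2.2 - p.2.1 ^ 2) ≠ 0}.Finite) ∧
    ∀ τ : ℂ, 0 < τ.im →
      (Summable fun n : ℕ =>
        ‖(dLambert a b c (n + 1) : ℂ) * qq τ ^ (n + 1) / (1 - qq τ ^ (n + 1))‖) ∧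
      thetaA a b c τ ^ 2 =
        1 + 4 * ∑' n : ℕ,
          (dLambert a b c (n + 1) : ℂ) * qq τ ^ (n + 1) / (1 - qq τ ^ (n + 1)) := by
  refine ⟨fun n hn => support_finite ha hD n hn, fun τ hτ => ?_⟩
  have hQ0 : qq τ ≠ 0 := Complex.exp_ne_zero _
  have hQ : ‖qq τ‖ < 1 := by
    rw [qq, Complex.norm_exp, Real.exp_lt_one_iff]
    have : (2 * Real.pi * Complex.I * τ).re = -(2 * Real.pi * τ.im) := by
      simp
    rw [this]
    have := Real.pi_pos
    have : 0 < 2 * Real.pi * τ.im := by positivity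
    linarith
  obtain ⟨h1, h2⟩ := lambert ha hD (qq τ) hQ
  refine ⟨h1, ?_⟩
  have h3 := theta_sq ha hD (qq τ) hQ0 hQ
  rw [thetaA, h2, ← h3.tsum_eq, h3.summable.tsum_eq_zero_add, ← tsum_mul_left]
  congr 1
  · rw [Nat.cast_zero, Rset_zero ha hD]; simp
  · refine tsum_congr fun n => ?_
    have := Rset_card_div ha hD (n + 1) (by omega)
    have h := congrArg (Int.cast (R := ℂ)) this
    push_cast at h ⊢
    rw [h]
    ring
end
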